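/- Let c be a nonnegative integer or half-integer and λ a partition (padded with zeros to length n) or a half-partition with exactly n parts. Then, as an identity of rational functions (in y_1,…,y_n with x_j = y_j^2 when half-integer exponents occur), so_{2n+1}((c^n); x^{±1}) · so_{2n+1}(λ; x^{±1}) = Σ_{ν} so_{2n+1}(ν; x^{±1}) · Σ_{μ ⊆ ((2c)^n)} LRbar^{ν+(c^n)}_{λ,μ}(c), where the outer sum ranges over all partitions ν if λ+(c^n) = (λ_1+c,…,λ_n+c) is a partition, resp. all half-partitions ν if λ+(c^n) is a half-partition, with exactly n parts (zero parts allowed in the partition case) satisfying ν_i ≤ λ_i + c and λ_i + c − ν_i ∈ ℤ for all i, and the inner sum ranges over all partitions μ contained in ((2c)^n). -/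

import Mathlib

open scoped Classical
open Finset

noncomputable section

/-- The field of rational functions in `n` variables over `ℚ`. -/
abbrev FF (n : ℕ) : Type := FractionRing (MvPolynomial (Fin n) ℚ)

/-- The variables, as elements of the rational function field. -/
def Xv (n : ℕ) : Fin n → FF n := fun i =>
  algebraMap (MvPolynomial (Fin n) ℚ) (FF n) (MvPolynomial.X i)

/-- Irreducible odd orthogonal character `so_{2n+1}(λ; x^{±1})`, written in the
variables `y` where `x_j = y_j²`; here `L` is the doubled index, `L = 2λ`. -/
def soOdd {F : Type} [Field F] (n : ℕ) (L : Fin n → ℤ) (y : Fin n → F) : F :=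
  Matrix.det (Matrix.of fun i j : Fin n =>
    y j ^ (L i + 2 * (n : ℤ) - 2 * ((i : ℕ) : ℤ) - 1) -
      y j ^ (-(L i + 2 * (n : ℤ) - 2 * ((i : ℕ) : ℤ) - 1))) /
  Matrix.det (Matrix.of fun i j : Fin n =>
    y j ^ (2 * (n : ℤ) - 2 * ((i : ℕ) : ℤ) - 1) -
      y j ^ (-(2 * (n : ℤ) - 2 * ((i : ℕ) : ℤ) - 1)))

/-- The cells of the skew shape `A/Λ` in doubled coordinates: in row `i` the
(doubled) column indices run through `Λ i < J ≤ A i` with `J ≡ A i (mod 2)`. -/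
def cellsOf (n : ℕ) (Λ A : Fin n → ℤ) : Finset (Fin n × ℤ) :=
  Finset.univ.biUnion (fun i : Fin n =>
    ((Finset.Ioc (Λ i) (A i)).filter (fun J => (A i - J) % 2 = 0)).image (fun J => (i, J)))

/-- `F` is a Littlewood–Richardson filling of the skew shape `A/Λ` (in doubled
coordinates) with content `μ`: entries lie in `{1, …, n}` (and are `0` off the
shape), rows weakly increase, columns strictly increase, entry `e+1` occurs `μ e`
times, and the lattice condition holds for the right-to-left row reading word. -/
def IsLRFilling (n : ℕ) (Λ A : Fin n → ℤ) (μ : Fin n → ℕ) (F : Fin n → ℤ → ℕ) : Prop :=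
  (∀ i, Λ i ≤ A i ∧ (A i - Λ i) % 2 = 0) ∧
  (∀ i J, (i, J) ∉ cellsOf n Λ A → F i J = 0) ∧
  (∀ i J, (i, J) ∈ cellsOf n Λ A → 1 ≤ F i J ∧ F i J ≤ n) ∧
  (∀ i J, (i, J) ∈ cellsOf n Λ A → (i, J + 2) ∈ cellsOf n Λ A → F i J ≤ F i (J + 2)) ∧
  (∀ i i' : Fin n, ∀ J : ℤ, i < i' → (i, J) ∈ cellsOf n Λ A → (i', J) ∈ cellsOf n Λ A →
      F i J < F i' J) ∧
  (∀ e : Fin n,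
    ((cellsOf n Λ A).filter (fun c => F c.1 c.2 = (e : ℕ) + 1)).card = μ e) ∧
  (∀ i : Fin n, ∀ J : ℤ, ∀ e : ℕ,
    ((cellsOf n Λ A).filter
        (fun c => (c.1 < i ∨ (c.1 = i ∧ J ≤ c.2)) ∧ F c.1 c.2 = e + 2)).card ≤
    ((cellsOf n Λ A).filter
        (fun c => (c.1 < i ∨ (c.1 = i ∧ J ≤ c.2)) ∧ F c.1 c.2 = e + 1)).card)

/-- Condition (∗): an entry `e` in the last row in (doubled) column `J = 2j` has at
least `2c - 2j + 1 = C2 - J + 1` further entries `e` strictly to its right. -/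
def StarCond (n : ℕ) (Λ A : Fin n → ℤ) (C2 : ℤ) (F : Fin n → ℤ → ℕ) : Prop :=
  ∀ i : Fin n, (i : ℕ) + 1 = n → ∀ J : ℤ, (i, J) ∈ cellsOf n Λ A →
    C2 - J + 1 ≤
      (((cellsOf n Λ A).filter (fun c => F c.1 c.2 = F i J ∧ J < c.2)).card : ℤ)

/-- The modified Littlewood–Richardson coefficient
`LRbar^{A/2}_{Λ/2, μ}(C2/2)` (doubled coordinates). -/
def LRbar (n : ℕ) (Λ A : Fin n → ℤ) (μ : Fin n → ℕ) (C2 : ℤ) : ℕ :=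
  Nat.card {F : Fin n → ℤ → ℕ // IsLRFilling n Λ A μ F ∧ StarCond n Λ A C2 F}




/-- Upper bound for the entry `r` of a row `v` between rows `u` (below) and `w` (above). -/
def upB (u w : ℕ → ℤ) (r : ℕ) : ℤ := if r = 0 then u 0 else min (u r) (w (r - 1))

/-- Lower bound for the entry `r` of a row. -/
def dnB (u w : ℕ → ℤ) (r : ℕ) : ℤ := max (u (r + 1)) (w r)

/-- Truncated Bender-Knuth toggle of a row `v` between `u` and `w`. -/
def togRow (p : ℤ) (u w v : ℕ → ℤ) (r : ℕ) : ℤ :=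
  if v r ≤ p then min p (upB u w r) + dnB u w r - v r else v r

/-- `u`, `v`, `w` are three consecutive rows of a pattern. -/
structure GTRows (N : ℕ) (u v w : ℕ → ℤ) : Prop where
  vu : ∀ r, v r ≤ u r
  uv : ∀ r, u (r + 1) ≤ v r
  wv : ∀ r, w r ≤ v r
  vw : ∀ r, v (r + 1) ≤ w r
  w0 : ∀ r, 0 ≤ w r
  uN : ∀ r, N ≤ r → u r = 0

/-- Sum of positive parts. -/
def Hs (N : ℕ) (v : ℕ → ℤ) (p : ℤ) : ℤ := ∑ r ∈ range N, max (v r - p) 0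

theorem upB_succ (u w : ℕ → ℤ) (r : ℕ) : upB u w (r + 1) = min (u (r + 1)) (w r) := by
  simp [upB]

theorem GTRows.le_up {N u v w} (h : GTRows N u v w) (r : ℕ) : v r ≤ upB u w r := by
  cases r with
  | zero => simpa [upB] using h.vu 0
  | succ r => rw [upB_succ]; exact le_min (h.vu _) (h.vw _)

theorem GTRows.dn_le {N u v w} (h : GTRows N u v w) (r : ℕ) : dnB u w r ≤ v r :=
  max_le (h.uv _) (h.wv _)

theorem togRow_inter {N u v w} (h : GTRows N u v w) (p : ℤ) :
    GTRows N u (togRow p u w v) w := by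
  have key : ∀ r, dnB u w r ≤ togRow p u w v r ∧ togRow p u w v r ≤ upB u w r := by
    intro r
    have h1 := h.le_up r
    have h2 := h.dn_le r
    unfold togRow
    split_ifs with hp
    · have h3 : v r ≤ min p (upB u w r) := le_min hp h1
      have h4 : min p (upB u w r) ≤ upB u w r := min_le_right _ _
      constructor <;> linarith
    · exact ⟨h2, h1⟩
  refine ⟨fun r => (key r).2.trans ?_, fun r => le_trans (le_max_left _ _) (key r).1,
    fun r => le_trans (le_max_right _ _) (key r).1, fun r => (key (r+1)).2.trans ?_, h.w0, h.uN⟩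
  · cases r with
    | zero => simp [upB]
    | succ r => rw [upB_succ]; exact min_le_left _ _
  · rw [upB_succ]; exact min_le_right _ _

theorem togRow_tog {N u v w} (h : GTRows N u v w) (p : ℤ) :
    togRow p u w (togRow p u w v) = v := by
  funext r
  have h1 := h.le_up r
  have h2 := h.dn_le r
  by_cases hp : v r ≤ p
  · have h3 : v r ≤ min p (upB u w r) := le_min hp h1
    have h4 : min p (upB u w r) ≤ p := min_le_left _ _
    have e : togRow p u w v r = min p (upB u w r) + dnB u w r - v r := by simp [togRow, hp]
    have h5 : togRow p u w v r ≤ p := by linarith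
    have : togRow p u w (togRow p u w v) r
      = min p (upB u w r) + dnB u w r - togRow p u w v r := by
      conv_lhs => unfold togRow
      exact if_pos h5
    linarith
  · have e : togRow p u w v r = v r := by simp [togRow, hp]
    have : togRow p u w (togRow p u w v) r = togRow p u w v r := by
      conv_lhs => unfold togRow
      exact if_neg (by rw [← togRow, e]; exact hp)
    linarith

theorem togRow_pos {N u v w} (h : GTRows N u v w) (p q : ℤ) (hq : p ≤ q) (r : ℕ) :
    max (togRow p u w v r - q) 0 = max (v r - q) 0 := by
  have h1 := h.le_up r
  have h2 := h.dn_le r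
  by_cases hp : v r ≤ p
  · have h3 : v r ≤ min p (upB u w r) := le_min hp h1
    have h4 : min p (upB u w r) ≤ p := min_le_left _ _
    have e : togRow p u w v r = min p (upB u w r) + dnB u w r - v r := by simp [togRow, hp]
    rw [max_eq_right, max_eq_right] <;> linarith
  · have e : togRow p u w v r = v r := by simp [togRow, hp]
    rw [e]

theorem togRow_Hs {N u v w} (h : GTRows N u v w) (M : ℕ) (p q : ℤ) (hq : p ≤ q) :
    Hs M (togRow p u w v) q = Hs M v q :=
  Finset.sum_congr rfl fun r _ => togRow_pos h p q hq r

theorem sum_up_dn (u w : ℕ → ℤ) (p : ℤ) (N : ℕ) :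
    ∑ r ∈ range N, (min p (upB u w r) + min p (dnB u w r)) + min p (upB u w N)
      = ∑ r ∈ range (N + 1), min p (u r) + ∑ r ∈ range N, min p (w r) := by
  induction N with
  | zero => simp [upB]
  | succ N ih =>
    rw [Finset.sum_range_succ, Finset.sum_range_succ (fun r => min p (u r)) (N + 1),
      Finset.sum_range_succ (fun r => min p (w r)) N]
    have : min p (dnB u w N) + min p (upB u w (N + 1)) = min p (u (N + 1)) + min p (w N) := by
      rw [upB_succ, dnB]
      rcases le_total (u (N+1)) (w N) with h | h
      · rw [max_eq_right h, min_eq_left h, add_comm]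
      · rw [max_eq_left h, min_eq_right h]
    linarith

theorem togRow_sum {N u v w} (h : GTRows N u v w) (p : ℤ) (hp0 : 0 ≤ p)
    (hc : ∀ r, p < v r → p < w r) :
    ∑ r ∈ range N, togRow p u w v r
      = ∑ r ∈ range N, u r + ∑ r ∈ range N, w r - ∑ r ∈ range N, v r
        + (2 * Hs N v p - Hs N w p - Hs N u p) := by
  have hmin : ∀ x : ℤ, min p x = x - max (x - p) 0 := by
    intro x; rcases le_total x p with hx | hx
    · rw [min_eq_right hx, max_eq_right (by linarith)]; ring
    · rw [min_eq_left hx, max_eq_left (by linarith)]; ring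
  have pt : ∀ r, togRow p u w v r =
      (min p (upB u w r) + min p (dnB u w r)) + 2 * max (v r - p) 0 - v r := by
    intro r
    have h1 := h.le_up r
    have h2 := h.dn_le r
    unfold togRow
    split_ifs with hp
    · rw [min_eq_right (h2.trans hp), max_eq_right (by linarith)]; ring
    · push Not at hp
      have h3 : p ≤ dnB u w r := le_trans (hc r hp).le (le_max_right _ _)
      rw [min_eq_left h3, min_eq_left (by linarith), max_eq_left (by linarith)]; ring
  have hS := sum_up_dn u w p N
  have hv0 : ∀ r, 0 ≤ v r := fun r => (h.w0 r).trans (h.wv r)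
  have hup : upB u w N = 0 := by
    refine le_antisymm ?_ ((hv0 N).trans (h.le_up N))
    have := h.uN N le_rfl
    cases N with
    | zero => simp [upB, this]
    | succ N => rw [upB_succ]; exact (min_le_left _ _).trans this.le
  rw [hup, Finset.sum_range_succ, h.uN N le_rfl] at hS
  simp only [pt, Finset.sum_sub_distrib, Finset.sum_add_distrib, ← Finset.mul_sum] at *
  have e1 : ∑ r ∈ range N, min p (u r) = ∑ r ∈ range N, u r - Hs N u p := by
    simp only [hmin, Finset.sum_sub_distrib, Hs]
  have e2 : ∑ r ∈ range N, min p (w r) = ∑ r ∈ range N, w r - Hs N w p := by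
    simp only [hmin, Finset.sum_sub_distrib, Hs]
  rw [e1, e2] at hS
  simp only [Hs] at *
  linarith

/-- The one-step analysis of the column `p + 1`. -/
theorem step_cond {N u v w} (h : GTRows N u v w) (p : ℤ) (hp0 : 0 ≤ p) (l : ℤ)
    (h1 : 0 ≤ l + (2 * Hs N v (p + 1) - Hs N w (p + 1) - Hs N u (p + 1)))
    (h2 : l + (2 * Hs N v p - Hs N w p - Hs N u p) < 0) :
    (∀ r, p < v r → p < w r) ∧ l + (2 * Hs N v p - Hs N w p - Hs N u p) = -1 := by
  let d : ℤ → ℤ := fun x => if p < x then 1 else 0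
  have hd : ∀ x : ℤ, max (x - p) 0 = max (x - (p + 1)) 0 + d x := by
    intro x
    by_cases hx : p < x
    · simp only [d, if_pos hx]
      rw [max_eq_left (by linarith), max_eq_left (by linarith [Int.add_one_le_of_lt hx])]; ring
    · simp only [d, if_neg hx]
      rw [max_eq_right (by linarith), max_eq_right (by linarith)]; ring
  have dm : ∀ x y : ℤ, x ≤ y → d x ≤ d y := by
    intro x y hxy
    simp only [d]; split_ifs <;> first | omega | simp
  have hH : ∀ z : ℕ → ℤ, Hs N z p = Hs N z (p + 1) + ∑ r ∈ range N, d (z r) := by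
    intro z; simp only [Hs, hd, Finset.sum_add_distrib]
  have d0 : ∀ x, 0 ≤ d x ∧ d x ≤ 1 := by
    intro x; simp only [d]; split_ifs <;> simp
  have tel : ∀ M, ∑ r ∈ range M, d (u r) ≤ 1 + ∑ r ∈ range M, d (v r) := by
    intro M
    have : ∑ r ∈ range (M + 1), d (u r) ≤ 1 + ∑ r ∈ range M, d (v r) := by
      rw [Finset.sum_range_succ']
      have := Finset.sum_le_sum (s := range M) fun r _ => dm _ _ (h.uv r)
      linarith [(d0 (u 0)).2]
    rw [Finset.sum_range_succ] at this
    linarith [(d0 (u M)).1]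
  have hx : ∑ r ∈ range N, d (w r) ≤ ∑ r ∈ range N, d (v r) :=
    Finset.sum_le_sum fun r _ => dm _ _ (h.wv r)
  have ht := tel N
  have eu := hH u
  have ev := hH v
  have ew := hH w
  refine ⟨?_, by linarith⟩
  have heq : ∑ r ∈ range N, d (w r) = ∑ r ∈ range N, d (v r) := by linarith
  have := (Finset.sum_eq_sum_iff_of_le (fun r _ => dm _ _ (h.wv r))).1 heq
  intro r hr
  by_cases hrN : r < N
  · have := this r (Finset.mem_range.2 hrN)
    by_contra hc
    simp only [d, if_pos hr, if_neg hc] at this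
    omega
  · have := h.uN r (by omega)
    have := h.vu r
    omega


/-- Gelfand-Tsetlin patterns: row `i` (`i ≤ n`) has `i` entries between `0` and `C`. -/
structure GT (n C : ℕ) (g : ℕ → ℕ → ℤ) : Prop where
  zero : ∀ r, g 0 r = 0
  out : ∀ i, n < i → ∀ r, g i r = 0
  dn : ∀ i, i < n → ∀ r, g (i + 1) (r + 1) ≤ g i r
  up : ∀ i, i < n → ∀ r, g i r ≤ g (i + 1) r
  nonneg : ∀ i r, 0 ≤ g i r
  le : ∀ i r, g i r ≤ C

theorem GT.supp {n C g} (h : GT n C g) : ∀ i r, i ≤ r → g i r = 0 := by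
  intro i
  induction i with
  | zero => intro r _; exact h.zero r
  | succ i ih =>
    intro r hr
    by_cases hi : i < n
    · obtain ⟨s, rfl⟩ : ∃ s, r = s + 1 := ⟨r - 1, by omega⟩
      have h1 := h.dn i hi s
      rw [ih s (by omega)] at h1
      exact le_antisymm h1 (h.nonneg _ _)
    · exact h.out _ (by omega) r

/-- The (possibly virtual) row `k + 2`. -/
def dnRow (n C : ℕ) (g : ℕ → ℕ → ℤ) (k : ℕ) : ℕ → ℤ :=
  if k + 1 < n then g (k + 2) else fun r => if r = 0 then (C : ℤ) else g k (r - 1)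

theorem GT.rows {n C g} (h : GT n C g) (k : ℕ) (hk : k < n) :
    GTRows (n + 1) (dnRow n C g k) (g (k + 1)) (g k) := by
  by_cases hk1 : k + 1 < n
  · simp only [dnRow, if_pos hk1]
    exact ⟨h.up _ hk1, h.dn _ hk1, h.up _ hk, h.dn _ hk, h.nonneg _,
      fun r hr => h.supp _ _ (by omega)⟩
  · simp only [dnRow, if_neg hk1]
    refine ⟨fun r => ?_, fun r => ?_, h.up _ hk, h.dn _ hk, h.nonneg _, fun r hr => ?_⟩
    · cases r with
      | zero => simpa using h.le _ _
      | succ r => simpa using h.dn _ hk r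
    · simpa using h.up _ hk r
    · rw [if_neg (by omega)]; exact h.supp _ _ (by omega)

/-- The truncated toggle of row `k + 1`. -/
def tog (n C : ℕ) (p : ℤ) (k : ℕ) (g : ℕ → ℕ → ℤ) : ℕ → ℕ → ℤ :=
  Function.update g (k + 1) (togRow p (dnRow n C g k) (g k) (g (k + 1)))

theorem tog_same (n C p k g) :
    tog n C p k g (k + 1) = togRow p (dnRow n C g k) (g k) (g (k + 1)) := by
  simp [tog]

theorem tog_ne (n C p k g) (i : ℕ) (hi : i ≠ k + 1) : tog n C p k g i = g i := by
  simp [tog, hi]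

theorem dnRow_tog (n C p k g) : dnRow n C (tog n C p k g) k = dnRow n C g k := by
  unfold dnRow
  rw [tog_ne _ _ _ _ _ (k + 2) (by omega), tog_ne _ _ _ _ _ k (by omega)]

theorem tog_tog {n C g} (h : GT n C g) (p : ℤ) (k : ℕ) (hk : k < n) :
    tog n C p k (tog n C p k g) = g := by
  funext i
  by_cases hi : i = k + 1
  · subst hi
    rw [tog_same, dnRow_tog, tog_ne _ _ _ _ _ k (by omega), tog_same]
    exact togRow_tog (h.rows k hk) p
  · rw [tog_ne _ _ _ _ _ i hi, tog_ne _ _ _ _ _ i hi]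

theorem tog_GT {n C g} (h : GT n C g) (p : ℤ) (k : ℕ) (hk : k < n) :
    GT n C (tog n C p k g) := by
  have hr := togRow_inter (h.rows k hk) p
  rw [← tog_same] at hr
  set g' := tog n C p k g with hg'
  have ne : ∀ i, i ≠ k + 1 → g' i = g i := fun i hi => tog_ne _ _ _ _ _ i hi
  have dC : ∀ r, dnRow n C g k r ≤ C := by
    intro r
    unfold dnRow
    split_ifs with h1
    · exact h.le _ _
    · by_cases hr : r = 0
      · simp [hr]
      · simpa [hr] using h.le _ _
  refine ⟨?_, ?_, ?_, ?_, ?_, ?_⟩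
  · intro r; rw [ne 0 (by omega)]; exact h.zero r
  · intro i hi r; rw [ne i (by omega)]; exact h.out i hi r
  · intro i hi r
    by_cases h1 : i = k
    · subst h1; rw [ne i (by omega)]; exact hr.vw r
    · by_cases h2 : i = k + 1
      · subst h2
        have := hr.uv r
        simp only [dnRow, if_pos hi] at this
        rwa [ne (k + 1 + 1) (by omega)]
      · rw [ne i h2, ne (i+1) (by omega)]; exact h.dn i hi r
  · intro i hi r
    by_cases h1 : i = k
    · subst h1; rw [ne i (by omega)]; exact hr.wv r
    · by_cases h2 : i = k + 1
      · subst h2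
        have := hr.vu r
        simp only [dnRow, if_pos hi] at this
        rwa [ne (k + 1 + 1) (by omega)]
      · rw [ne i h2, ne (i+1) (by omega)]; exact h.up i hi r
  · intro i r
    by_cases h2 : i = k + 1
    · subst h2; exact (hr.w0 r).trans (hr.wv r)
    · rw [ne i h2]; exact h.nonneg i r
  · intro i r
    by_cases h2 : i = k + 1
    · subst h2; exact (hr.vu r).trans (dC r)
    · rw [ne i h2]; exact h.le i r

/-- The partial pairing with the coroot `k`. -/
def ff (n C : ℕ) (l : ℕ → ℤ) (g : ℕ → ℕ → ℤ) (k : ℕ) (p : ℤ) : ℤ :=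
  l k + (2 * Hs (n + 1) (g (k + 1)) p - Hs (n + 1) (g k) p - Hs (n + 1) (dnRow n C g k) p)

theorem Hs_shift (n : ℕ) (c : ℤ) (z : ℕ → ℤ) (p : ℤ) :
    Hs (n + 1) (fun r => if r = 0 then c else z (r - 1)) p = Hs n z p + max (c - p) 0 := by
  simp [Hs, Finset.sum_range_succ']

theorem tog_Hs {n C g} (h : GT n C g) (p q : ℤ) (hq : p ≤ q) (k : ℕ) (hk : k < n) (M i : ℕ) :
    Hs M (tog n C p k g i) q = Hs M (g i) q := by
  by_cases hi : i = k + 1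
  · subst hi; rw [tog_same]; exact togRow_Hs (h.rows k hk) M p q hq
  · rw [tog_ne _ _ _ _ _ i hi]

theorem tog_ff {n C g} (h : GT n C g) (l : ℕ → ℤ) (p q : ℤ) (hq : p ≤ q) (k : ℕ) (hk : k < n)
    (k' : ℕ) : ff n C l (tog n C p k g) k' q = ff n C l g k' q := by
  have : Hs (n + 1) (dnRow n C (tog n C p k g) k') q = Hs (n + 1) (dnRow n C g k') q := by
    unfold dnRow
    split_ifs with h1
    · exact tog_Hs h p q hq k hk _ _
    · rw [Hs_shift, Hs_shift, tog_Hs h p q hq k hk]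
  unfold ff
  rw [this, tog_Hs h p q hq k hk, tog_Hs h p q hq k hk]

/-- Row sums. -/
def Ss (n : ℕ) (g : ℕ → ℕ → ℤ) (i : ℕ) : ℤ := ∑ r ∈ range (n + 1), g i r

theorem sum_dnRow {n C g} (h : GT n C g) (k : ℕ) (hk : k < n) :
    ∑ r ∈ range (n + 1), dnRow n C g k r = if k + 1 < n then Ss n g (k + 2) else C + Ss n g k := by
  unfold dnRow
  split_ifs with h1
  · rfl
  · rw [Finset.sum_range_succ', Ss, Finset.sum_range_succ, h.supp k n (by omega)]
    simp [add_comm]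

/-- Doubled weight. -/
def wt (n C : ℕ) (g : ℕ → ℕ → ℤ) : Fin n → ℤ := fun i =>
  2 * (Ss n g (i + 1) - Ss n g i) - C

/-- Simple reflections. -/
def wrefl (n : ℕ) (k : Fin n) (x : Fin n → ℤ) : Fin n → ℤ :=
  if h : (k : ℕ) + 1 < n then x ∘ Equiv.swap k ⟨k + 1, h⟩ else Function.update x k (- x k)

theorem tog_wt {n C g} (h : GT n C g) (p : ℤ) (k : Fin n)
    (hc : ∀ r, p < g (k + 1) r → p < g k r) (hp : 0 ≤ p)
    (M : Fin n → ℤ) (c : ℤ) (hcc : 2 * Hs (n + 1) (g (k + 1)) p - Hs (n + 1) (g k) p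
      - Hs (n + 1) (dnRow n C g k) p = - c)
    (hM1 : ∀ h : (k : ℕ) + 1 < n, M k - M ⟨k + 1, h⟩ = 2 * c)
    (hM2 : (k : ℕ) + 1 = n → M k = c) :
    (fun i => M i + wt n C (tog n C p k g) i) = wrefl n k (fun i => M i + wt n C g i) := by
  have hs := togRow_sum (h.rows k k.2) p hp hc
  rw [← tog_same, hcc, sum_dnRow h k k.2] at hs
  change Ss n (tog n C p k g) (k + 1) = _ + Ss n g k - Ss n g (k + 1) + _ at hs
  have hne : ∀ i : ℕ, i ≠ k + 1 → Ss n (tog n C p k g) i = Ss n g i := by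
    intro i hi; simp only [Ss, tog_ne _ _ _ _ _ i hi]
  funext i
  unfold wrefl
  split_ifs with h1
  · have hM := hM1 h1
    rw [if_pos h1] at hs
    by_cases e1 : i = k
    · subst e1
      simp only [Function.comp, Equiv.swap_apply_left, wt]
      rw [hs, hne i (by omega)]
      linarith
    · have e1' : (i : ℕ) ≠ k := fun e => e1 (Fin.ext e)
      by_cases e2 : i = ⟨k + 1, h1⟩
      · subst e2
        simp only [Function.comp, Equiv.swap_apply_right, wt]
        rw [hs, hne (k + 1 + 1) (by omega)]
        linarith
      · have e2' : (i : ℕ) ≠ k + 1 := fun e => e2 (Fin.ext e)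
        simp only [Function.comp, Equiv.swap_apply_of_ne_of_ne e1 e2, wt]
        rw [hne _ e2', hne (i + 1) (by omega)]
  · have hM := hM2 (by omega)
    rw [if_neg h1] at hs
    by_cases e1 : i = k
    · subst e1
      simp only [Function.update_self, wt]
      rw [hs, hne i (by omega)]
      linarith
    · have e1' : (i : ℕ) ≠ k := fun e => e1 (Fin.ext e)
      simp only [Function.update_of_ne e1, wt]
      have := i.2
      rw [hne i (by omega), hne (i + 1) (by omega)]

theorem GT_finite (n C : ℕ) : {g | GT n C g}.Finite := by
  let φ : (ℕ → ℕ → ℤ) → (Fin (n + 1) → Fin (n + 1) → ℤ) := fun g i r => g i r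
  have hf : (Set.pi Set.univ fun _ : Fin (n + 1) => Set.pi Set.univ fun _ : Fin (n + 1) =>
      Set.Icc (0 : ℤ) C).Finite :=
    Set.Finite.pi' (fun _ => Set.Finite.pi' fun _ => Set.finite_Icc _ _) |>.subset (by
      intro x hx i r; exact hx i trivial r trivial)
  refine Set.Finite.of_finite_image (f := φ) (hf.subset ?_) ?_
  · rintro _ ⟨g, hg, rfl⟩ i _ r _
    exact ⟨hg.nonneg _ _, hg.le _ _⟩
  · intro g hg g' hg' e
    funext i r
    by_cases hi : i ≤ n
    · by_cases hr : r ≤ n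
      · exact congrFun (congrFun e ⟨i, by omega⟩) ⟨r, by omega⟩
      · rw [hg.supp i r (by omega), hg'.supp i r (by omega)]
    · rw [GT.out hg i (by omega), GT.out hg' i (by omega)]

/-- All patterns. -/
def BB (n C : ℕ) : Finset (ℕ → ℕ → ℤ) := (GT_finite n C).toFinset

theorem mem_BB {n C g} : g ∈ BB n C ↔ GT n C g := by simp [BB]

/-- Weyl group invariance under simple reflections. -/
theorem sum_refl {R : Type*} [AddCommMonoid R] (n C : ℕ) (k : Fin n) (φ : (Fin n → ℤ) → R) :
    ∑ g ∈ BB n C, φ (wrefl n k (wt n C g)) = ∑ g ∈ BB n C, φ (wt n C g) := by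
  have hw : ∀ g, GT n C g → wt n C (tog n C C k g) = wrefl n k (wt n C g) := by
    intro g h
    have hz : ∀ z : ℕ → ℤ, (∀ r, z r ≤ C) → Hs (n + 1) z C = 0 := by
      intro z hz
      refine Finset.sum_eq_zero fun r _ => max_eq_right (by linarith [hz r])
    have := tog_wt h C k (fun r hr => absurd (h.le _ _) (not_le.2 hr)) (by positivity)
      (fun _ => 0) 0 (by
        rw [hz _ (h.le _), hz _ (h.le _), hz]
        · simp
        · intro r
          unfold dnRow
          split_ifs with h1
          · exact h.le _ _
          · by_cases hr : r = 0
            · simp [hr]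
            · simpa [hr] using h.le _ _) (by simp) (by simp)
    simpa using this
  refine Finset.sum_bij' (fun g _ => tog n C C k g) (fun g _ => tog n C C k g) ?_ ?_ ?_ ?_ ?_
  · intro g hg; exact mem_BB.2 (tog_GT (mem_BB.1 hg) _ _ k.2)
  · intro g hg; exact mem_BB.2 (tog_GT (mem_BB.1 hg) _ _ k.2)
  · intro g hg; exact tog_tog (mem_BB.1 hg) _ _ k.2
  · intro g hg; exact tog_tog (mem_BB.1 hg) _ _ k.2
  · intro g hg; rw [hw g (mem_BB.1 hg)]


/-- The alternant with exponents `M`. -/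
def aa {F : Type} [Field F] {n : ℕ} (y : Fin n → F) (M : Fin n → ℤ) : F :=
  Matrix.det (Matrix.of fun i j : Fin n => y j ^ (M i) - y j ^ (-(M i)))

theorem aa_refl {F : Type} [Field F] {n : ℕ} (y : Fin n → F) (M : Fin n → ℤ) (k : Fin n) :
    aa y (wrefl n k M) = - aa y M := by
  unfold wrefl
  split_ifs with h
  · have hne : k ≠ ⟨k + 1, h⟩ := by
      intro e; have := congrArg Fin.val e; simp at this
    have := Matrix.det_permute (Equiv.swap k ⟨k + 1, h⟩)
      (Matrix.of fun i j : Fin n => y j ^ (M i) - y j ^ (-(M i)))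
    rw [Equiv.Perm.sign_swap hne] at this
    simpa [aa, Matrix.submatrix] using this
  · have := Matrix.det_mul_column (fun i => if i = k then (-1 : F) else 1)
      (Matrix.of fun i j : Fin n => y j ^ (M i) - y j ^ (-(M i)))
    rw [Finset.prod_ite_eq' Finset.univ k] at this
    simp only [Finset.mem_univ, if_true, neg_one_mul] at this
    rw [aa, aa, ← this]
    congr 1
    ext i j
    by_cases e : i = k
    · subst e; simp
    · simp [e]

/-- Maps of the weight space under which the weight multiset is invariant. -/
def WInv (F : Type) [Field F] (n C : ℕ) (u : (Fin n → ℤ) → (Fin n → ℤ)) : Prop :=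
  ∀ φ : (Fin n → ℤ) → F, ∑ g ∈ BB n C, φ (u (wt n C g)) = ∑ g ∈ BB n C, φ (wt n C g)

theorem WInv.comp {F : Type} [Field F] {n C : ℕ} {u v : (Fin n → ℤ) → (Fin n → ℤ)}
    (hu : WInv F n C u) (hv : WInv F n C v) : WInv F n C (fun x => u (v x)) := by
  intro φ
  rw [hv (fun x => φ (u x)), hu φ]

theorem WInv_perm (F : Type) [Field F] (n C : ℕ) (σ : Equiv.Perm (Fin n)) :
    WInv F n C (fun x => x ∘ σ) := by
  cases n with
  | zero =>
    intro φ
    refine Finset.sum_congr rfl fun g _ => ?_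
    congr 1
    exact Subsingleton.elim _ _
  | succ n =>
    have hσ : σ ∈ Submonoid.closure
        (Set.range fun i : Fin n => Equiv.swap i.castSucc i.succ) := by
      rw [Equiv.Perm.mclosure_swap_castSucc_succ]; trivial
    induction hσ using Submonoid.closure_induction with
    | mem x hx =>
      obtain ⟨i, rfl⟩ := hx
      intro φ
      have := sum_refl (n + 1) C i.castSucc φ
      rw [← this]
      refine Finset.sum_congr rfl fun g _ => ?_
      congr 1
      unfold wrefl
      rw [dif_pos (by simp)]
      rfl
    | one => intro φ; rfl
    | mul x y _ _ hx hy => exact WInv.comp (u := fun z => z ∘ y) (v := fun z => z ∘ x) hy hx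

/-- Sign changes. -/
def flipT {n : ℕ} (T : Finset (Fin n)) (x : Fin n → ℤ) : Fin n → ℤ :=
  fun j => if j ∈ T then - x j else x j

theorem WInv_flip1 (F : Type) [Field F] (n C : ℕ) (a : Fin n) :
    WInv F n C (fun x => flipT {a} x) := by
  let k : Fin n := ⟨n - 1, by have := a.2; omega⟩
  have h1 : WInv F n C (wrefl n k) := fun φ => sum_refl n C k φ
  have h2 := WInv.comp (WInv_perm F n C (Equiv.swap a k))
    (WInv.comp h1 (WInv_perm F n C (Equiv.swap a k)))
  have : (fun x : Fin n → ℤ => flipT {a} x) =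
      fun x => (wrefl n k (x ∘ Equiv.swap a k)) ∘ Equiv.swap a k := by
    funext x j
    unfold wrefl
    rw [dif_neg (by have := a.2; simp only [k]; omega)]
    simp only [flipT, Finset.mem_singleton, Function.comp]
    by_cases hj : j = a
    · subst hj; simp
    · have hne : Equiv.swap a k j ≠ k := by
        intro e
        exact hj ((Equiv.swap a k).injective (by rw [e, Equiv.swap_apply_left]))
      rw [Function.update_of_ne hne]
      simp [hj]
  rw [this]
  exact h2

theorem WInv_flip (F : Type) [Field F] (n C : ℕ) (T : Finset (Fin n)) :
    WInv F n C (fun x => flipT T x) := by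
  induction T using Finset.induction_on with
  | empty =>
    intro φ
    refine Finset.sum_congr rfl fun g _ => ?_
    congr 1
  | insert a T ha ih =>
    have := WInv.comp (WInv_flip1 F n C a) ih
    have e : (fun x : Fin n → ℤ => flipT {a} (flipT T x)) = fun x => flipT (insert a T) x := by
      funext x j
      by_cases hj : j = a
      · subst hj; simp [flipT, ha]
      · simp [flipT, hj]
    rwa [e] at this

/-- The character of the set of patterns. -/
def chi {F : Type} [Field F] (n C : ℕ) (y : Fin n → F) : F :=
  ∑ g ∈ BB n C, ∏ j, y j ^ (wt n C g j)

theorem aa_expand {F : Type} [Field F] {n : ℕ} (y : Fin n → F) (M : Fin n → ℤ) :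
    aa y M = ∑ σ : Equiv.Perm (Fin n), ∑ T : Finset (Fin n),
      ((Equiv.Perm.sign σ : ℤ) : F) * (-1) ^ T.card * ∏ j, y j ^ (flipT T (M ∘ σ) j) := by
  unfold aa
  rw [Matrix.det_apply']
  refine Finset.sum_congr rfl fun σ _ => ?_
  simp only [Matrix.of_apply]
  have : ∀ j, y j ^ M (σ j) - y j ^ (-M (σ j)) = -(y j ^ (-M (σ j))) + y j ^ M (σ j) :=
    fun j => by ring
  simp only [this]
  rw [Finset.prod_add, Finset.mul_sum, Finset.powerset_univ]
  refine Finset.sum_congr rfl fun T _ => ?_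
  rw [Finset.prod_neg, mul_assoc, mul_assoc]
  congr 2
  rw [← Finset.prod_sdiff (Finset.subset_univ T), mul_comm]
  congr 1
  · refine Finset.prod_congr rfl fun j hj => ?_
    have : j ∉ T := (Finset.mem_sdiff.1 hj).2
    simp [flipT, this]
  · refine Finset.prod_congr rfl fun j hj => ?_
    simp [flipT, hj]

theorem chi_mul_aa {F : Type} [Field F] (n C : ℕ) (y : Fin n → F) (hy : ∀ j, y j ≠ 0)
    (M : Fin n → ℤ) :
    chi n C y * aa y M = ∑ g ∈ BB n C, aa y (fun i => M i + wt n C g i) := by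
  have hinv : ∀ (σ : Equiv.Perm (Fin n)) (T : Finset (Fin n)),
      chi n C y = ∑ g ∈ BB n C, ∏ j, y j ^ (flipT T (wt n C g ∘ σ) j) := by
    intro σ T
    have := WInv.comp (WInv_flip F n C T) (WInv_perm F n C σ)
    exact (this (fun x => ∏ j, y j ^ (x j))).symm
  simp only [aa_expand]
  rw [Finset.mul_sum, Finset.sum_comm]
  refine Finset.sum_congr rfl fun σ _ => ?_
  rw [Finset.mul_sum, Finset.sum_comm]
  refine Finset.sum_congr rfl fun T _ => ?_
  rw [hinv σ T, Finset.sum_mul]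
  refine Finset.sum_congr rfl fun g _ => ?_
  rw [mul_comm, mul_assoc, ← Finset.prod_mul_distrib]
  congr 1
  refine Finset.prod_congr rfl fun j _ => ?_
  rw [← zpow_add₀ (hy j)]
  congr 1
  simp only [flipT, Function.comp]
  split_ifs <;> ring

/-- Good patterns. -/
def Good (n C : ℕ) (l : ℕ → ℤ) (g : ℕ → ℕ → ℤ) : Prop :=
  ∀ p k : ℕ, p ≤ C → k < n → 0 ≤ ff n C l g k p

/-- Partially good patterns. -/
def OkUpTo (n C : ℕ) (l : ℕ → ℤ) (p k : ℕ) (g : ℕ → ℕ → ℤ) : Prop :=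
  ∀ p' k' : ℕ, p' ≤ C → k' < n → (p < p' ∨ (p' = p ∧ k' < k)) → 0 ≤ ff n C l g k' p'

theorem ff_top {n C g} (h : GT n C g) (l : ℕ → ℤ) (k : ℕ) : ff n C l g k C = l k := by
  have hz : ∀ z : ℕ → ℤ, (∀ r, z r ≤ C) → Hs (n + 1) z C = 0 := by
    intro z hz
    refine Finset.sum_eq_zero fun r _ => max_eq_right (by linarith [hz r])
  unfold ff
  rw [hz _ (h.le _), hz _ (h.le _), hz]
  · simp
  · intro r
    unfold dnRow
    split_ifs with h1
    · exact h.le _ _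
    · by_cases hr : r = 0
      · simp [hr]
      · simpa [hr] using h.le _ _

theorem cancel_step {F : Type} [Field F] [CharZero F] (n C : ℕ) (y : Fin n → F)
    (l : ℕ → ℤ) (hl : ∀ k, 0 ≤ l k) (M : Fin n → ℤ)
    (hM1 : ∀ (k : Fin n) (h : (k : ℕ) + 1 < n), M k - M ⟨k + 1, h⟩ = 2 * (l k + 1))
    (hM2 : ∀ (k : Fin n), (k : ℕ) + 1 = n → M k = l k + 1) (p : ℕ) (hpC : p ≤ C) (k : Fin n) :
    ∑ g ∈ (BB n C).filter (fun g => OkUpTo n C l p k g ∧ ff n C l g k p < 0),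
      aa y (fun i => M i + wt n C g i) = 0 := by
  set X := (BB n C).filter (fun g => OkUpTo n C l p k g ∧ ff n C l g k p < 0) with hX
  have hmem : ∀ g ∈ X, tog n C p k g ∈ X := by
    intro g hg
    simp only [hX, Finset.mem_filter, mem_BB] at hg ⊢
    obtain ⟨h, h1, h2⟩ := hg
    refine ⟨tog_GT h _ _ k.2, ?_, ?_⟩
    · intro p' k' a1 a2 a3
      rw [tog_ff h l p p' (by rcases a3 with a | a <;> exact_mod_cast (by omega)) k k.2]
      exact h1 p' k' a1 a2 a3
    · rw [tog_ff h l p p le_rfl k k.2]; exact h2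
  have hneg : ∀ g ∈ X, aa y (fun i => M i + wt n C (tog n C p k g) i)
      = - aa y (fun i => M i + wt n C g i) := by
    intro g hg
    simp only [hX, Finset.mem_filter, mem_BB] at hg
    obtain ⟨h, h1, h2⟩ := hg
    have hlt : p < C := by
      rcases Nat.lt_or_ge p C with h3 | h3
      · exact h3
      · have : p = C := le_antisymm hpC h3
        subst this
        rw [ff_top h] at h2
        linarith [hl k]
    have h3 := h1 (p + 1) k hlt k.2 (Or.inl (by omega))
    push_cast at h3
    obtain ⟨hc, he⟩ := step_cond (h.rows k k.2) p (by positivity) (l k) h3 h2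
    rw [tog_wt h p k hc (by positivity) M (l k + 1) (by linarith) (hM1 k) (hM2 k), aa_refl]
  have hs : ∑ g ∈ X, aa y (fun i => M i + wt n C g i)
      = ∑ g ∈ X, - aa y (fun i => M i + wt n C g i) := by
    refine Finset.sum_bij' (fun g _ => tog n C p k g) (fun g _ => tog n C p k g)
      hmem hmem ?_ ?_ ?_
    · intro g hg
      exact tog_tog (mem_BB.1 (Finset.mem_filter.1 hg).1) _ _ k.2
    · intro g hg
      exact tog_tog (mem_BB.1 (Finset.mem_filter.1 hg).1) _ _ k.2
    · intro g hg; rw [hneg g hg, neg_neg]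
  rw [Finset.sum_neg_distrib] at hs
  have h2 : (2 : F) * ∑ g ∈ X, aa y (fun i => M i + wt n C g i) = 0 := by linear_combination hs
  simpa using h2

theorem sum_good {F : Type} [Field F] [CharZero F] (n C : ℕ) (y : Fin n → F)
    (l : ℕ → ℤ) (hl : ∀ k, 0 ≤ l k) (M : Fin n → ℤ)
    (hM1 : ∀ (k : Fin n) (h : (k : ℕ) + 1 < n), M k - M ⟨k + 1, h⟩ = 2 * (l k + 1))
    (hM2 : ∀ (k : Fin n), (k : ℕ) + 1 = n → M k = l k + 1) :
    ∑ g ∈ BB n C, aa y (fun i => M i + wt n C g i)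
      = ∑ g ∈ (BB n C).filter (Good n C l), aa y (fun i => M i + wt n C g i) := by
  set φ : (ℕ → ℕ → ℤ) → F := fun g => aa y (fun i => M i + wt n C g i) with hφ
  have hk : ∀ p, p ≤ C → ∀ k, k ≤ n → ∑ g ∈ (BB n C).filter (OkUpTo n C l p 0), φ g
      = ∑ g ∈ (BB n C).filter (OkUpTo n C l p k), φ g := by
    intro p hp k
    induction k with
    | zero => intro _; rfl
    | succ k ih =>
      intro hk
      rw [ih (by omega)]
      have hz := cancel_step n C y l hl M hM1 hM2 p hp ⟨k, by omega⟩
      rw [← Finset.sum_filter_add_sum_filter_not _ (fun g => 0 ≤ ff n C l g k p),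
        Finset.filter_filter, Finset.filter_filter]
      simp only [not_le]
      erw [hz]
      rw [add_zero]
      refine Finset.sum_congr (Finset.filter_congr fun g _ => ?_) fun _ _ => rfl
      constructor
      · rintro ⟨a, b⟩ p' k' a1 a2 a3
        by_cases h : p' = p ∧ k' = k
        · rw [h.1, h.2]; exact b
        · exact a p' k' a1 a2 (by omega)
      · intro a
        exact ⟨fun p' k' a1 a2 a3 => a p' k' a1 a2 (by omega), a p k hp (by omega) (by omega)⟩
  have hp : ∀ d, d ≤ C → ∑ g ∈ BB n C, φ g
      = ∑ g ∈ (BB n C).filter (OkUpTo n C l (C - d) n), φ g := by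
    intro d
    induction d with
    | zero =>
      intro _
      rw [← hk _ (by omega) n le_rfl]
      refine Finset.sum_congr (Finset.filter_true_of_mem fun g _ => ?_).symm fun _ _ => rfl
      intro p' k' a1 a2 a3; omega
    | succ d ih =>
      intro hd
      rw [ih (by omega), ← hk (C - (d + 1)) (by omega) n le_rfl]
      refine Finset.sum_congr (Finset.filter_congr fun g _ => ?_) fun _ _ => rfl
      constructor
      · intro a p' k' a1 a2 a3; exact a p' k' a1 a2 (by omega)
      · intro a p' k' a1 a2 a3; exact a p' k' a1 a2 (by omega)
  rw [hp C le_rfl]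
  refine Finset.sum_congr (Finset.filter_congr fun g _ => ?_) fun _ _ => rfl
  constructor
  · intro a p' k' a1 a2; exact a p' k' a1 a2 (by omega)
  · intro a p' k' a1 a2 a3; exact a p' k' a1 a2


/-- The pattern of highest weight. -/
def gmax (n C : ℕ) : ℕ → ℕ → ℤ := fun i r => if r < i ∧ i ≤ n then (C : ℤ) else 0

theorem gmax_GT (n C : ℕ) : GT n C (gmax n C) := by
  have hC : (0 : ℤ) ≤ C := by positivity
  refine ⟨?_, ?_, ?_, ?_, ?_, ?_⟩
  · intro r; simp [gmax]
  · intro i hi r; simp only [gmax]; rw [if_neg (by omega)]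
  all_goals
    intros
    simp only [gmax]
    split_ifs <;> first | omega | rfl

theorem Hs_split {N : ℕ} {z : ℕ → ℤ} {p : ℤ} (e : ℕ) (he : e ≤ N) (h1 : ∀ r, r < e → p ≤ z r)
    (h2 : ∀ r, e ≤ r → z r ≤ p) : Hs N z p = ∑ r ∈ range e, z r - e * p := by
  have : Hs N z p = ∑ r ∈ range e, max (z r - p) 0 := by
    unfold Hs
    symm
    refine Finset.sum_subset (Finset.range_subset_range.2 he) fun r _ hr => ?_
    exact max_eq_right (by have := h2 r (by simpa using hr); linarith)
  rw [this, Finset.sum_congr rfl fun r hr =>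
    max_eq_left (show 0 ≤ z r - p by linarith [h1 r (Finset.mem_range.1 hr)])]
  simp

theorem Hs_split' {N : ℕ} {z : ℕ → ℤ} {p : ℤ} (e : ℕ) (he : e < N) (h1 : ∀ r, r < e → p ≤ z r)
    (h2 : ∀ r, e < r → z r ≤ p) :
    Hs N z p = ∑ r ∈ range e, z r - e * p + max (z e - p) 0 := by
  rcases le_total p (z e) with h | h
  · rw [Hs_split (e + 1) he (fun r hr => ?_) (fun r hr => h2 r hr), Finset.sum_range_succ,
      max_eq_left (by linarith)]
    · push_cast; ring
    · rcases Nat.lt_or_ge r e with a | a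
      · exact h1 r a
      · rw [show r = e by omega]; exact h
  · rw [Hs_split e he.le h1 (fun r hr => ?_), max_eq_right (by linarith)]
    · ring
    · rcases Nat.lt_or_ge e r with a | a
      · exact h2 r a
      · rw [show r = e by omega]; exact h

theorem gmax_Hs (n C : ℕ) (M i : ℕ) (hi : i ≤ n) (hM : i ≤ M) (p : ℤ) (hp : 0 ≤ p)
    (hpC : p ≤ C) : Hs M (gmax n C i) p = i * (C - p) := by
  rw [Hs_split i hM]
  · rw [Finset.sum_congr rfl fun r hr => show gmax n C i r = C by
      simp [gmax, Finset.mem_range.1 hr, hi]]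
    simp; ring
  · intro r hr; simp [gmax, hr, hi, hpC]
  · intro r hr; simp only [gmax]; rw [if_neg (by omega)]; exact hp

theorem gmax_Good (n C : ℕ) : Good n C (fun _ => 0) (gmax n C) := by
  intro p k hp hk
  have hp' : (p : ℤ) ≤ C := by exact_mod_cast hp
  unfold ff
  rw [gmax_Hs n C _ _ (by omega) (by omega) p (by positivity) hp',
    gmax_Hs n C _ _ (by omega) (by omega) p (by positivity) hp']
  unfold dnRow
  split_ifs with h1
  · rw [gmax_Hs n C _ _ (by omega) (by omega) p (by positivity) hp']
    push_cast; ring_nf; rfl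
  · rw [Hs_shift, gmax_Hs n C _ _ (by omega) (by omega) p (by positivity) hp',
      max_eq_left (by linarith)]
    push_cast; ring_nf; linarith

theorem good_zero_eq {n C g} (h : GT n C g) (hg : Good n C (fun _ => 0) g) : g = gmax n C := by
  rcases Nat.eq_zero_or_pos C with hC | hC
  · subst hC
    funext i r
    have h1 := h.nonneg i r
    have h2 := h.le i r
    simp only [gmax]
    push_cast at *
    simp; linarith
  · let hh : ℕ → ℤ := fun i => Hs (n + 1) (g i) (C - 1)
    have hd : ∀ d k, k + 1 + d = n → hh k + 1 ≤ hh (k + 1) := by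
      intro d
      induction d with
      | zero =>
        intro k hk
        have h1 := hg (C - 1) k (by omega) (by omega)
        unfold ff dnRow at h1
        rw [if_neg (by omega), Hs_shift] at h1
        have h2 : Hs (n + 1) (g k) ((C - 1 : ℕ) : ℤ) = Hs n (g k) ((C - 1 : ℕ) : ℤ) := by
          unfold Hs
          rw [Finset.sum_range_succ, h.supp k n (by omega), max_eq_right (by omega)]
          ring
        rw [← h2] at h1
        push_cast [hC] at h1
        rw [max_eq_left (by linarith)] at h1
        simp only [hh]
        omega
      | succ d ih =>
        intro k hk
        have h1 := hg (C - 1) k (by omega) (by omega)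
        unfold ff dnRow at h1
        rw [if_pos (by omega)] at h1
        have h2 := ih (k + 1) (by omega)
        push_cast [hC] at h1
        simp only [hh] at *
        rw [show k + 1 + 1 = k + 2 by rfl] at h2
        omega
    have hi : ∀ i, i ≤ n → (i : ℤ) ≤ hh i := by
      intro i
      induction i with
      | zero => intro _; exact Finset.sum_nonneg fun r _ => le_max_right _ _
      | succ i ih =>
        intro hi
        have h1 := ih (by omega)
        have h2 := hd (n - (i + 1)) i (by omega)
        push_cast; linarith
    funext i r
    simp only [gmax]
    split_ifs with hc
    · have e : hh i = ∑ r ∈ range i, max (g i r - (C - 1)) 0 := by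
        simp only [hh, Hs]
        symm
        refine Finset.sum_subset (Finset.range_subset_range.2 (by omega)) fun r _ hr => ?_
        rw [h.supp i r (by simpa using hr)]
        exact max_eq_right (by omega)
      have hle : ∀ r ∈ range i, max (g i r - (C - 1)) 0 ≤ 1 := by
        intro r _
        have := h.le i r
        exact max_le (by linarith) (by norm_num)
      have hs : ∑ r ∈ range i, max (g i r - (C - 1)) 0 = ∑ r ∈ range i, (1 : ℤ) := by
        refine le_antisymm (Finset.sum_le_sum hle) ?_
        rw [← e]; simpa using hi i hc.2
      have := (Finset.sum_eq_sum_iff_of_le hle).1 hs r (Finset.mem_range.2 hc.1)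
      have h3 := h.le i r
      omega
    · by_cases hin : i ≤ n
      · exact h.supp i r (by omega)
      · exact h.out i (by omega) r

theorem wt_gmax (n C : ℕ) : wt n C (gmax n C) = fun _ => (C : ℤ) := by
  funext i
  have : ∀ j, j ≤ n → Ss n (gmax n C) j = j * C := by
    intro j hj
    have := gmax_Hs n C (n + 1) j hj (by omega) 0 le_rfl (by positivity)
    simp only [sub_zero] at this
    rw [← this]
    unfold Hs Ss
    refine Finset.sum_congr rfl fun r _ => ?_
    have := (gmax_GT n C).nonneg j r
    rw [max_eq_left] <;> simpa using this
  unfold wt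
  rw [this _ (by omega), this _ (by omega)]
  push_cast; ring

theorem filter_good_zero (n C : ℕ) : (BB n C).filter (Good n C fun _ => 0) = {gmax n C} := by
  ext g
  simp only [Finset.mem_filter, mem_BB, Finset.mem_singleton]
  constructor
  · rintro ⟨h1, h2⟩; exact good_zero_eq h1 h2
  · rintro rfl; exact ⟨gmax_GT n C, gmax_Good n C⟩

/-- The hive-type inequality. -/
def QQ (l : ℤ) (u v w : ℕ → ℤ) (e : ℕ) : ℤ :=
  l + 2 * ∑ r ∈ range e, v r - ∑ r ∈ range e, w r - ∑ r ∈ range e, u r - (u e - v e)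

theorem rows_good_iff {n : ℕ} {u v w : ℕ → ℤ} (h : GTRows (n + 1) u v w) (hv : v n = 0)
    (C : ℕ) (hC : ∀ r, v r ≤ C) (l : ℤ) :
    (∀ p : ℕ, p ≤ C → 0 ≤ l + (2 * Hs (n + 1) v p - Hs (n + 1) w p - Hs (n + 1) u p)) ↔
      ∀ e, e ≤ n → 0 ≤ QQ l u v w e := by
  have anti : Antitone v := antitone_nat_of_succ_le fun r => (h.vw r).trans (h.wv r)
  have v0 : ∀ r, 0 ≤ v r := fun r => (h.w0 r).trans (h.wv r)
  constructor
  · intro H e he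
    have h1 := H (v e).toNat (by have := hC e; omega)
    rw [Int.toNat_of_nonneg (v0 e)] at h1
    rw [Hs_split e (by omega) (fun r hr => anti hr.le) (fun r hr => anti hr),
      Hs_split (z := w) e (by omega) (fun r hr => (anti (show r + 1 ≤ e from hr)).trans (h.vw r))
        (fun r hr => (h.wv r).trans (anti hr)),
      Hs_split' (z := u) e (by omega) (fun r hr => (anti hr.le).trans (h.vu r))
        (fun r hr => by
          obtain ⟨s, rfl⟩ : ∃ s, r = s + 1 := ⟨r - 1, by omega⟩
          exact (h.uv s).trans (anti (by omega))),
      max_eq_left (by linarith [h.vu e])] at h1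
    unfold QQ
    linarith
  · intro H p _
    have hex : ∃ e, v e ≤ p := ⟨n, by rw [hv]; positivity⟩
    obtain ⟨e, he, hmin⟩ : ∃ e, v e ≤ p ∧ ∀ r, r < e → (p : ℤ) < v r :=
      ⟨Nat.find hex, Nat.find_spec hex, fun r hr => not_le.1 (Nat.find_min hex hr)⟩
    have hen : e ≤ n := by
      by_contra hc
      have := hmin n (by omega)
      rw [hv] at this
      omega
    have hge : ∀ r, e ≤ r → v r ≤ p := fun r hr => (anti hr).trans he
    rw [Hs_split e (by omega) (fun r hr => (hmin r hr).le) hge,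
      Hs_split' (z := u) e (by omega) (fun r hr => (hmin r hr).le.trans (h.vu r))
        (fun r hr => by
          obtain ⟨s, rfl⟩ : ∃ s, r = s + 1 := ⟨r - 1, by omega⟩
          exact (h.uv s).trans (hge s (by omega)))]
    have q1 := H e hen
    unfold QQ at q1
    have hmx : max (u e - p) 0 ≤ u e - v e := max_le (by linarith) (by linarith [h.vu e])
    cases e with
    | zero =>
      rw [Hs_split (z := w) 0 (by omega) (by simp) (fun r hr => (h.wv r).trans (hge r hr))]
      simp only [Finset.range_zero, Finset.sum_empty, Nat.cast_zero] at q1 ⊢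
      linarith
    | succ e =>
      have hw : ∀ r, r < e → (p : ℤ) ≤ w r := fun r hr =>
        (hmin (r + 1) (by omega)).le.trans (h.vw r)
      have hw2 : ∀ r, e < r → w r ≤ p := fun r hr => (h.wv r).trans (hge r hr)
      rw [Hs_split' (z := w) e (by omega) hw hw2]
      rcases le_total (p : ℤ) (w e) with hc | hc
      · rw [max_eq_left (show 0 ≤ w e - p by linarith)]
        rw [Finset.sum_range_succ w e] at q1
        push_cast
        linarith
      · rw [max_eq_right (show w e - p ≤ 0 by linarith)]
        have q0 := H e (by omega)
        unfold QQ at q0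
        have hm2 : max (u (e + 1) - p) 0 ≤ v e - p :=
          max_le (by linarith [h.uv e]) (by linarith [hmin e (by omega)])
        rw [Finset.sum_range_succ v e, Finset.sum_range_succ u e]
        push_cast
        linarith

theorem good_iff {n C g} (h : GT n C g) (l : ℕ → ℤ) :
    Good n C l g ↔ ∀ k, k < n → ∀ e, e ≤ n → 0 ≤ QQ (l k) (dnRow n C g k) (g (k + 1)) (g k) e := by
  constructor
  · intro H k hk
    exact (rows_good_iff (h.rows k hk) (h.supp _ _ (by omega)) C (h.le _) (l k)).1
      fun p hp => H p k hp hk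
  · intro H p k hp hk
    exact (rows_good_iff (h.rows k hk) (h.supp _ _ (by omega)) C (h.le _) (l k)).2 (H k hk) p hp

/-- Partial content of row `k` of the filling. -/
def PP (g : ℕ → ℕ → ℤ) (k e : ℕ) : ℤ := ∑ r ∈ range e, (g (k + 1) r - g k r)

theorem QQ_mid {n C g} {k : ℕ} (hk : k + 1 < n) (l : ℤ) (e : ℕ) :
    QQ l (dnRow n C g k) (g (k + 1)) (g k) e = l + PP g k e - PP g (k + 1) (e + 1) := by
  simp only [QQ, PP, dnRow, if_pos hk, Finset.sum_range_succ, Finset.sum_sub_distrib]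
  ring

theorem QQ_last {n C g} {k : ℕ} (hk : k + 1 = n) (l : ℤ) (e : ℕ) :
    QQ l (dnRow n C g k) (g (k + 1)) (g k) e = l + 2 * PP g k e + g n e - C := by
  have h1 : ∑ r ∈ range (e + 1), dnRow n C g k r = C + ∑ r ∈ range e, g k r := by
    simp only [dnRow, if_neg (show ¬ k + 1 < n by omega)]
    rw [Finset.sum_range_succ']
    simp [add_comm]
  rw [Finset.sum_range_succ] at h1
  simp only [QQ, PP, Finset.sum_sub_distrib]
  subst hk
  linarith


theorem mem_cells {n : ℕ} {Λ A : Fin n → ℤ} {i : Fin n} {J : ℤ} :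
    (i, J) ∈ cellsOf n Λ A ↔ Λ i < J ∧ J ≤ A i ∧ (A i - J) % 2 = 0 := by
  simp only [cellsOf, Finset.mem_biUnion, Finset.mem_univ, true_and, Finset.mem_image,
    Finset.mem_filter, Finset.mem_Ioc, Prod.mk.injEq]
  constructor
  · rintro ⟨i', J', ⟨⟨a, b⟩, c⟩, rfl, rfl⟩; exact ⟨a, b, c⟩
  · rintro ⟨a, b, c⟩; exact ⟨i, J, ⟨⟨a, b⟩, c⟩, rfl, rfl⟩

theorem card_par (a A : ℤ) (N : ℕ) (h : (A - a) % 2 = 0) :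
    ((Finset.Ioc a (a + 2 * N)).filter (fun J => (A - J) % 2 = 0)).card = N := by
  have : (Finset.Ioc a (a + 2 * N)).filter (fun J => (A - J) % 2 = 0)
      = (Finset.range N).image (fun k : ℕ => a + 2 * (k + 1)) := by
    ext J
    simp only [Finset.mem_filter, Finset.mem_Ioc, Finset.mem_image, Finset.mem_range]
    constructor
    · rintro ⟨⟨h1, h2⟩, h3⟩
      exact ⟨((J - a) / 2 - 1).toNat, by omega, by omega⟩
    · rintro ⟨k, hk, rfl⟩
      refine ⟨⟨by omega, by omega⟩, by omega⟩
  rw [this, Finset.card_image_of_injective, Finset.card_range]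
  intro x y hxy
  simp only at hxy
  omega

/-- Count of the cells of row `i` in columns `(a, a + 2N]`. -/
theorem card_row {n : ℕ} {Λ A : Fin n → ℤ} (i : Fin n) (a : ℤ) (N : ℕ) (h : (A i - a) % 2 = 0)
    (h1 : Λ i ≤ a) (h2 : a + 2 * N ≤ A i) (P : Fin n × ℤ → Prop) [DecidablePred P]
    (hP : ∀ c ∈ cellsOf n Λ A, P c ↔ c.1 = i ∧ a < c.2 ∧ c.2 ≤ a + 2 * N) :
    ((cellsOf n Λ A).filter P).card = N := by
  rw [← card_par a (A i) N h]
  symm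
  refine Finset.card_bij (fun J _ => (i, J)) ?_ ?_ ?_
  · intro J hJ
    simp only [Finset.mem_filter, Finset.mem_Ioc] at hJ
    have hc : (i, J) ∈ cellsOf n Λ A := mem_cells.2 ⟨by omega, by omega, hJ.2⟩
    exact Finset.mem_filter.2 ⟨hc, (hP _ hc).2 ⟨rfl, hJ.1⟩⟩
  · intro J _ J' _ e; exact (Prod.mk.injEq _ _ _ _ ▸ e).2
  · rintro ⟨i', J⟩ hc
    obtain ⟨hc, hp⟩ := Finset.mem_filter.1 hc
    obtain ⟨e, h3, h4⟩ := (hP _ hc).1 hp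
    simp only at e h3 h4
    subst e
    exact ⟨J, Finset.mem_filter.2 ⟨Finset.mem_Ioc.2 ⟨h3, h4⟩, (mem_cells.1 hc).2.2⟩, rfl⟩

/-- Number of entries `e + 1` in the first `i` rows. -/
def cnt {n : ℕ} (Λ A : Fin n → ℤ) (F : Fin n → ℤ → ℕ) (i e : ℕ) : ℕ :=
  ((cellsOf n Λ A).filter (fun c => (c.1 : ℕ) < i ∧ F c.1 c.2 = e + 1)).card

/-- Number of entries `e + 1` in row `i`. -/
def rcnt {n : ℕ} (Λ A : Fin n → ℤ) (F : Fin n → ℤ → ℕ) (i e : ℕ) : ℕ :=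
  ((cellsOf n Λ A).filter (fun c => (c.1 : ℕ) = i ∧ F c.1 c.2 = e + 1)).card

theorem cnt_succ {n : ℕ} (Λ A : Fin n → ℤ) (F : Fin n → ℤ → ℕ) (i e : ℕ) :
    cnt Λ A F (i + 1) e = cnt Λ A F i e + rcnt Λ A F i e := by
  unfold cnt rcnt
  rw [← Finset.card_union_of_disjoint]
  · congr 1
    ext c
    simp only [Finset.mem_filter, Finset.mem_union]
    constructor
    · rintro ⟨a, b, c⟩
      rcases Nat.lt_succ_iff_lt_or_eq.1 b with h | h
      · exact Or.inl ⟨a, h, c⟩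
      · exact Or.inr ⟨a, h, c⟩
    · rintro (⟨a, b, c⟩ | ⟨a, b, c⟩) <;> exact ⟨a, by omega, c⟩
  · rw [Finset.disjoint_left]
    intro c h1 h2
    simp only [Finset.mem_filter] at h1 h2
    omega

theorem cnt_zero {n : ℕ} (Λ A : Fin n → ℤ) (F : Fin n → ℤ → ℕ) (e : ℕ) : cnt Λ A F 0 e = 0 := by
  simp [cnt]

/-- Right end of the entries `≤ e` in row `i`. -/
def XX {n : ℕ} (Λ : Fin n → ℤ) (g : ℕ → ℕ → ℤ) (i : Fin n) (e : ℕ) : ℤ := Λ i + 2 * PP g i e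

theorem XX_zero {n : ℕ} (Λ : Fin n → ℤ) (g : ℕ → ℕ → ℤ) (i : Fin n) : XX Λ g i 0 = Λ i := by
  simp [XX, PP]

theorem XX_succ {n : ℕ} (Λ : Fin n → ℤ) (g : ℕ → ℕ → ℤ) (i : Fin n) (e : ℕ) :
    XX Λ g i (e + 1) = XX Λ g i e + 2 * (g (i + 1) e - g i e) := by
  simp only [XX, PP, Finset.sum_range_succ]; ring

/-- The filling `F` is encoded by the pattern `g`. -/
structure FillRep {n : ℕ} (Λ A : Fin n → ℤ) (g : ℕ → ℕ → ℤ) (F : Fin n → ℤ → ℕ) : Prop where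
  off : ∀ i J, (i, J) ∉ cellsOf n Λ A → F i J = 0
  on : ∀ i J, (i, J) ∈ cellsOf n Λ A → ∀ e, F i J ≤ e ↔ J ≤ XX Λ g i e

/-- Numerical side conditions on a pattern. -/
structure PatNum {n : ℕ} (Λ A : Fin n → ℤ) (g : ℕ → ℕ → ℤ) : Prop where
  par : ∀ i, (A i - Λ i) % 2 = 0
  le : ∀ i e, XX Λ g i e ≤ A i
  mono : ∀ i : Fin n, ∀ r, g i r ≤ g (i + 1) r
  zero : ∀ r, g 0 r = 0

theorem XX_mono {n : ℕ} {Λ A : Fin n → ℤ} {g} (h : PatNum Λ A g) (i : Fin n) :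
    Monotone (XX Λ g i) := by
  refine monotone_nat_of_le_succ fun e => ?_
  rw [XX_succ]; linarith [h.mono i e]

theorem XX_ge {n : ℕ} {Λ A : Fin n → ℤ} {g} (h : PatNum Λ A g) (i : Fin n) (e : ℕ) :
    Λ i ≤ XX Λ g i e := by
  rw [← XX_zero Λ g i]; exact XX_mono h i (Nat.zero_le e)

theorem XX_par {n : ℕ} {Λ A : Fin n → ℤ} {g} (h : PatNum Λ A g) (i : Fin n) (e : ℕ) :
    (A i - XX Λ g i e) % 2 = 0 := by
  have := h.par i
  unfold XX; omega

theorem rcnt_eq {n : ℕ} {Λ A : Fin n → ℤ} {g F} (h : PatNum Λ A g) (hr : FillRep Λ A g F) (i : Fin n)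
    (e : ℕ) : (rcnt Λ A F i e : ℤ) = g (i + 1) e - g i e := by
  have h1 := XX_succ Λ g i e
  have h2 := h.mono i e
  have h3 := h.le i (e + 1)
  unfold rcnt
  rw [card_row i (XX Λ g i e) (g (i + 1) e - g i e).toNat (XX_par h i e) (XX_ge h i e) (by omega)]
  · omega
  · rintro ⟨i', J⟩ hc
    simp only
    constructor
    · rintro ⟨a, b⟩
      have a' : i' = i := Fin.ext a
      subst a'
      refine ⟨rfl, ?_, ?_⟩
      · have := (hr.on _ _ hc e).not
        omega
      · have := (hr.on _ _ hc (e + 1))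
        omega
    · rintro ⟨rfl, b, c⟩
      have e1 := hr.on _ _ hc e
      have e2 := hr.on _ _ hc (e + 1)
      refine ⟨rfl, ?_⟩
      omega

theorem cnt_eq {n : ℕ} {Λ A : Fin n → ℤ} {g F} (h : PatNum Λ A g) (hr : FillRep Λ A g F) (e : ℕ) :
    ∀ i, i ≤ n → (cnt Λ A F i e : ℤ) = g i e := by
  intro i
  induction i with
  | zero => intro _; rw [cnt_zero, h.zero]; rfl
  | succ i ih =>
    intro hi
    have := rcnt_eq h hr ⟨i, by omega⟩ e
    simp only at this
    rw [cnt_succ]; push_cast; rw [ih (by omega), this]; ring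

/-- Every pattern encodes a filling. -/
theorem exists_rep {n : ℕ} {Λ A : Fin n → ℤ} {g} (h : PatNum Λ A g)
    (hA : ∀ i, XX Λ g i n = A i) : ∃ F, FillRep Λ A g F := by
  have hex : ∀ i J, (i, J) ∈ cellsOf n Λ A → ∃ e, J ≤ XX Λ g i e := by
    intro i J hc
    exact ⟨n, by rw [hA]; exact (mem_cells.1 hc).2.1⟩
  refine ⟨fun i J => if hc : (i, J) ∈ cellsOf n Λ A then Nat.find (hex i J hc) else 0, ?_, ?_⟩
  · intro i J hc; simp [hc]
  · intro i J hc e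
    simp only [hc, dif_pos]
    rw [Nat.find_le_iff]
    constructor
    · rintro ⟨m, hm, hJ⟩; exact hJ.trans (XX_mono h i hm)
    · intro hJ; exact ⟨e, le_rfl, hJ⟩

theorem rep_unique {n : ℕ} {Λ A : Fin n → ℤ} {g F F'} (h : FillRep Λ A g F) (h' : FillRep Λ A g F') :
    F = F' := by
  funext i J
  by_cases hc : (i, J) ∈ cellsOf n Λ A
  · apply le_antisymm
    · rw [h.on i J hc, ← h'.on i J hc]
    · rw [h'.on i J hc, ← h.on i J hc]
  · rw [h.off i J hc, h'.off i J hc]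

/-- The number of entries `e + 1` strictly right of column `J`, upper bound. -/
theorem right_row {n : ℕ} {Λ A : Fin n → ℤ} {g F} (h : PatNum Λ A g) (hr : FillRep Λ A g F) (i : Fin n)
    (J : ℤ) (e : ℕ) (hc : (i, J) ∈ cellsOf n Λ A) (hF : F i J = e + 1) :
    2 * (((cellsOf n Λ A).filter (fun c => c.1 = i ∧ F c.1 c.2 = e + 1 ∧ J < c.2)).card : ℤ)
      = XX Λ g i (e + 1) - J := by
  have h1 := (hr.on i J hc (e + 1)).1 hF.le
  have h2 : XX Λ g i e < J := by
    by_contra hn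
    have := (hr.on i J hc e).2 (not_lt.1 hn)
    omega
  have hm := mem_cells.1 hc
  have hp := XX_par h i (e + 1)
  rw [card_row i J ((XX Λ g i (e + 1) - J) / 2).toNat hm.2.2 hm.1.le
    (by have := h.le i (e + 1); omega)]
  · omega
  · rintro ⟨i', J'⟩ hc'
    simp only
    constructor
    · rintro ⟨rfl, b, c⟩
      have e2 := hr.on _ _ hc' (e + 1)
      refine ⟨rfl, c, ?_⟩
      omega
    · rintro ⟨rfl, b, c⟩
      have e1 := hr.on _ _ hc' e
      have e2 := hr.on _ _ hc' (e + 1)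
      refine ⟨rfl, ?_, b⟩
      omega

theorem star_le {n : ℕ} {Λ A : Fin n → ℤ} {F : Fin n → ℤ → ℕ} (i : Fin n)
    (hi : (i : ℕ) + 1 = n) (J : ℤ) (e : ℕ) :
    ((cellsOf n Λ A).filter (fun c => F c.1 c.2 = e + 1 ∧ J < c.2)).card
      ≤ cnt Λ A F i e
        + ((cellsOf n Λ A).filter (fun c => c.1 = i ∧ F c.1 c.2 = e + 1 ∧ J < c.2)).card := by
  unfold cnt
  refine le_trans (Finset.card_le_card ?_) (Finset.card_union_le _ _)
  intro c hc
  simp only [Finset.mem_filter, Finset.mem_union] at hc ⊢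
  by_cases h : c.1 = i
  · exact Or.inr ⟨hc.1, h, hc.2⟩
  · refine Or.inl ⟨hc.1, ?_, hc.2.1⟩
    have h1 : (c.1 : ℕ) ≠ i := fun e => h (Fin.ext e)
    have := c.1.2
    omega

theorem star_ge {n : ℕ} {Λ A : Fin n → ℤ} {F : Fin n → ℤ → ℕ} (i : Fin n) (J : ℤ) (e : ℕ)
    (H : ∀ c ∈ cellsOf n Λ A, c.1 < i → F c.1 c.2 = e + 1 → J < c.2) :
    cnt Λ A F i e
        + ((cellsOf n Λ A).filter (fun c => c.1 = i ∧ F c.1 c.2 = e + 1 ∧ J < c.2)).card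
      ≤ ((cellsOf n Λ A).filter (fun c => F c.1 c.2 = e + 1 ∧ J < c.2)).card := by
  unfold cnt
  rw [← Finset.card_union_of_disjoint]
  · refine Finset.card_le_card ?_
    intro c hc
    simp only [Finset.mem_filter, Finset.mem_union] at hc ⊢
    rcases hc with ⟨a, b, c⟩ | ⟨a, b, c⟩
    · exact ⟨a, c, H _ a b c⟩
    · exact ⟨a, c⟩
  · rw [Finset.disjoint_left]
    intro c h1 h2
    simp only [Finset.mem_filter] at h1 h2
    have := congrArg Fin.val h2.2.1
    omega


/-- The simple root coordinates of the highest weight. -/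
def lfun {n : ℕ} (Λ : Fin n → ℤ) (k : ℕ) : ℤ :=
  if h : k < n then (if h2 : k + 1 < n then (Λ ⟨k, h⟩ - Λ ⟨k + 1, h2⟩) / 2 else Λ ⟨k, h⟩) else 0

theorem lfun_nonneg {n : ℕ} {Λ : Fin n → ℤ} (hΛd : ∀ i j : Fin n, i ≤ j → Λ j ≤ Λ i)
    (hΛ0 : ∀ i, 0 ≤ Λ i) (k : ℕ) : 0 ≤ lfun Λ k := by
  unfold lfun
  split_ifs with h h2
  · have := hΛd ⟨k, h⟩ ⟨k + 1, h2⟩ (by simp [Fin.le_def])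
    omega
  · exact hΛ0 _
  · exact le_rfl

theorem lfun_mid {n : ℕ} {Λ : Fin n → ℤ} (hpar : ∀ i j, Λ i % 2 = Λ j % 2) (i i' : Fin n)
    (h : (i' : ℕ) = i + 1) : 2 * lfun Λ i = Λ i - Λ i' := by
  unfold lfun
  rw [dif_pos i.2, dif_pos (by have := i'.2; omega)]
  have e : (⟨(i : ℕ) + 1, by have := i'.2; omega⟩ : Fin n) = i' := Fin.ext h.symm
  rw [e]
  have := hpar i i'
  simp only [Fin.eta]
  omega

theorem lfun_last {n : ℕ} {Λ : Fin n → ℤ} (i : Fin n) (h : (i : ℕ) + 1 = n) :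
    lfun Λ i = Λ i := by
  unfold lfun
  rw [dif_pos i.2, dif_neg (by omega)]

theorem good_XX {n C g} {Λ : Fin n → ℤ} (h : GT n C g) (hpar : ∀ i j, Λ i % 2 = Λ j % 2) :
    Good n C (lfun Λ) g ↔
      (∀ i i' : Fin n, (i' : ℕ) = i + 1 → ∀ e, e ≤ n → XX Λ g i' (e + 1) ≤ XX Λ g i e) ∧
      (∀ i : Fin n, (i : ℕ) + 1 = n → ∀ e, e ≤ n → (C : ℤ) ≤ XX Λ g i e + g n e) := by
  rw [good_iff h]
  constructor
  · intro H
    constructor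
    · intro i i' hi e he
      have h1 := H i i.2 e he
      rw [QQ_mid (by have := i'.2; omega)] at h1
      have h2 := lfun_mid hpar i i' hi
      simp only [XX, hi]
      linarith
    · intro i hi e he
      have h1 := H i i.2 e he
      rw [QQ_last hi, lfun_last i hi] at h1
      simp only [XX]
      linarith
  · rintro ⟨H1, H2⟩ k hk e he
    by_cases hk1 : k + 1 < n
    · rw [QQ_mid hk1]
      have h1 := H1 ⟨k, hk⟩ ⟨k + 1, hk1⟩ rfl e he
      have h2 := lfun_mid hpar ⟨k, hk⟩ ⟨k + 1, hk1⟩ rfl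
      simp only [XX] at h1 h2
      linarith
    · rw [QQ_last (by omega)]
      have h1 := H2 ⟨k, hk⟩ (by simp only; omega) e he
      have h2 := lfun_last (Λ := Λ) ⟨k, hk⟩ (by simp only; omega)
      simp only [XX] at h1 h2
      linarith

theorem XX_wt {n C g} {Λ : Fin n → ℤ} (h : GT n C g) (i : Fin n) :
    XX Λ g i n = Λ i + wt n C g i + C := by
  have h1 := h.supp (i + 1) n i.2
  have h2 := h.supp i n i.2.le
  simp only [XX, wt, Ss, PP, Finset.sum_range_succ, Finset.sum_sub_distrib]
  rw [h1, h2]; ring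

theorem XX_stable {n C g} {Λ : Fin n → ℤ} (h : GT n C g) (i : Fin n) (e : ℕ) (he : n ≤ e) :
    XX Λ g i e = XX Λ g i n := by
  induction e, he using Nat.le_induction with
  | base => rfl
  | succ e he ih =>
    rw [XX_succ, ih, h.supp (i + 1) e (by have := i.2; omega), h.supp i e (by have := i.2; omega)]
    ring

/-- The patterns contributing to the coefficient of `V`. -/
structure GG (n C : ℕ) (Λ V : Fin n → ℤ) (g : ℕ → ℕ → ℤ) : Prop where
  gt : GT n C g
  good : Good n C (lfun Λ) g
  weight : ∀ i, V i = Λ i + wt n C g i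

theorem GG.XXn {n C g} {Λ V : Fin n → ℤ} (h : GG n C Λ V g) (i : Fin n) :
    XX Λ g i n = V i + C := by
  rw [XX_wt h.gt, h.weight]

theorem GG.num {n C g} {Λ V : Fin n → ℤ} (h : GG n C Λ V g) :
    PatNum Λ (fun i => V i + (C : ℤ)) g := by
  have mono : ∀ i : Fin n, Monotone (XX Λ g i) := by
    intro i
    refine monotone_nat_of_le_succ fun e => ?_
    rw [XX_succ]; linarith [h.gt.up i i.2 e]
  refine ⟨?_, ?_, fun i r => h.gt.up i i.2 r, h.gt.zero⟩
  · intro i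
    have := h.XXn i
    simp only [XX] at this
    omega
  · intro i e
    rw [← h.XXn i]
    rcases le_total e n with h1 | h1
    · exact mono i h1
    · exact (XX_stable h.gt i e h1).le

theorem GG.col {n C g} {Λ V : Fin n → ℤ} (h : GG n C Λ V g) (hpar : ∀ i j, Λ i % 2 = Λ j % 2)
    (e : ℕ) (he : e ≤ n) : ∀ d : ℕ, ∀ i i' : Fin n, (i' : ℕ) = i + 1 + d →
      XX Λ g i' (e + 1) ≤ XX Λ g i e := by
  have H := ((good_XX h.gt hpar).1 h.good).1
  intro d
  induction d with
  | zero => intro i i' hi; exact H i i' hi e he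
  | succ d ih =>
    intro i i' hi
    have hlt : (i : ℕ) + 1 + d < n := by have := i'.2; omega
    refine le_trans (H ⟨i + 1 + d, hlt⟩ i' hi e he) ?_
    exact le_trans (XX_mono h.num _ (Nat.le_succ e)) (ih i ⟨i + 1 + d, hlt⟩ rfl)

/-- A pattern gives a Littlewood-Richardson filling. -/
theorem rep_LR {n C g} {Λ V : Fin n → ℤ} (h : GG n C Λ V g) (hpar : ∀ i j, Λ i % 2 = Λ j % 2)
    {F : Fin n → ℤ → ℕ} (hr : FillRep Λ (fun i => V i + (C : ℤ)) g F) (μ : Fin n → ℕ)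
    (hμ : ∀ e : Fin n, g n e = μ e) :
    IsLRFilling n Λ (fun i => V i + (C : ℤ)) μ F ∧
      StarCond n Λ (fun i => V i + (C : ℤ)) C F := by
  have hn := h.num
  set A : Fin n → ℤ := fun i => V i + (C : ℤ) with hA
  have pos : ∀ i J, (i, J) ∈ cellsOf n Λ A → 1 ≤ F i J := by
    intro i J hc
    by_contra hcon
    have h1 := (hr.on i J hc 0).1 (by omega)
    rw [XX_zero] at h1
    have := (mem_cells.1 hc).1
    omega
  have len : ∀ i J, (i, J) ∈ cellsOf n Λ A → F i J ≤ n := by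
    intro i J hc
    rw [hr.on i J hc, h.XXn]
    exact (mem_cells.1 hc).2.1
  have colLe : ∀ i i' : Fin n, i < i' → ∀ e, e ≤ n → XX Λ g i' (e + 1) ≤ XX Λ g i e := by
    intro i i' hi e he
    exact h.col hpar e he (i' - i - 1) i i' (by have : (i : ℕ) < i' := hi; omega)
  refine ⟨⟨?_, hr.off, fun i J hc => ⟨pos i J hc, len i J hc⟩, ?_, ?_, ?_, ?_⟩, ?_⟩
  · intro i
    exact ⟨(XX_ge hn i 0).trans (hn.le i 0), hn.par i⟩
  · intro i J hc hc'
    rw [hr.on i J hc]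
    have := (hr.on i (J + 2) hc' _).1 le_rfl
    linarith
  · intro i i' J hi hc hc'
    have h1 := pos i' J hc'
    have h2 := len i' J hc'
    have h3 := (hr.on i' J hc' _).1 le_rfl
    obtain ⟨e, he⟩ : ∃ e, F i' J = e + 1 := ⟨F i' J - 1, by omega⟩
    rw [he] at h3 ⊢
    have := (hr.on i J hc e).2 (h3.trans (colLe i i' hi e (by omega)))
    omega
  · intro e
    have h1 := cnt_eq hn hr e n le_rfl
    rw [hμ] at h1
    have h2 : cnt Λ A F n e = μ e := by exact_mod_cast h1
    rw [← h2]
    unfold cnt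
    congr 1
    ext c
    simp
  · intro i J e
    have h1 := cnt_eq hn hr (e + 1) (i + 1) i.2
    have h2 := cnt_eq hn hr e i i.2.le
    have h3 := h.gt.dn i i.2 e
    have h4 : cnt Λ A F (i + 1) (e + 1) ≤ cnt Λ A F i e := by
      have : (cnt Λ A F (i + 1) (e + 1) : ℤ) ≤ cnt Λ A F i e := by rw [h1, h2]; exact h3
      exact_mod_cast this
    refine le_trans (le_trans (Finset.card_le_card ?_) h4) (Finset.card_le_card ?_)
    · intro c hc
      simp only [Finset.mem_filter] at hc ⊢
      refine ⟨hc.1, ?_, hc.2.2⟩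
      rcases hc.2.1 with hh | hh
      · have : (c.1 : ℕ) < i := hh
        omega
      · rw [hh.1]; omega
    · intro c hc
      simp only [Finset.mem_filter] at hc ⊢
      exact ⟨hc.1, Or.inl hc.2.1, hc.2.2⟩
  · intro i hi J hc
    have h1 := pos i J hc
    have h2 := len i J hc
    obtain ⟨e, he⟩ : ∃ e, F i J = e + 1 := ⟨F i J - 1, by omega⟩
    rw [he]
    have hJ1 := (hr.on i J hc (e + 1)).1 he.le
    have hJ2 : XX Λ g i e < J := by
      by_contra hcon
      have := (hr.on i J hc e).2 (not_lt.1 hcon)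
      omega
    have hs := star_ge (Λ := Λ) (A := A) (F := F) i J e (by
      rintro ⟨i', J'⟩ hc' hi' hF'
      simp only at hi' hF' ⊢
      have h5 : XX Λ g i' e < J' := by
        by_contra hcon
        have := (hr.on i' J' hc' e).2 (not_lt.1 hcon)
        omega
      have h6 := colLe i' i hi' e (by omega)
      linarith)
    have hrr := right_row hn hr i J e hc he
    have hcn := cnt_eq hn hr e i i.2.le
    have hlast := ((good_XX h.gt hpar).1 h.good).2 i hi e (by omega)
    have hX := XX_succ Λ g i e
    rw [hi] at hX
    have hp1 := XX_par hn i e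
    have hp2 := (mem_cells.1 hc).2.2
    have hs' : (cnt Λ A F i e : ℤ)
        + (((cellsOf n Λ A).filter (fun c => c.1 = i ∧ F c.1 c.2 = e + 1 ∧ J < c.2)).card : ℤ)
      ≤ (((cellsOf n Λ A).filter (fun c => F c.1 c.2 = e + 1 ∧ J < c.2)).card : ℤ) := by
      exact_mod_cast hs
    refine le_trans ?_ hs'
    rw [hcn]
    generalize (((cellsOf n Λ A).filter (fun c => c.1 = i ∧ F c.1 c.2 = e + 1 ∧ J < c.2)).card : ℤ) = R at *
    omega


/-- The pattern of a filling. -/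
def patOf {n : ℕ} (Λ A : Fin n → ℤ) (F : Fin n → ℤ → ℕ) : ℕ → ℕ → ℤ := fun i e =>
  if i ≤ n then (cnt Λ A F i e : ℤ) else 0

theorem patOf_le {n : ℕ} {Λ A : Fin n → ℤ} {F : Fin n → ℤ → ℕ} {i e : ℕ} (h : i ≤ n) :
    patOf Λ A F i e = cnt Λ A F i e := by
  simp [patOf, h]

theorem cnt_mono {n : ℕ} {Λ A : Fin n → ℤ} {F : Fin n → ℤ → ℕ} (e : ℕ) :
    Monotone fun i => cnt Λ A F i e := by
  refine monotone_nat_of_le_succ fun i => ?_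
  rw [cnt_succ]; omega

/-- Number of entries at most `e` in row `i`. -/
def rle {n : ℕ} (Λ A : Fin n → ℤ) (F : Fin n → ℤ → ℕ) (i : Fin n) (e : ℕ) : ℕ :=
  ((cellsOf n Λ A).filter (fun c => c.1 = i ∧ F c.1 c.2 ≤ e)).card

theorem PP_patOf {n : ℕ} {Λ A : Fin n → ℤ} {F : Fin n → ℤ → ℕ}
    (hpos : ∀ i J, (i, J) ∈ cellsOf n Λ A → 1 ≤ F i J) (i : Fin n) (e : ℕ) :
    PP (patOf Λ A F) i e = rle Λ A F i e := by
  induction e with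
  | zero =>
    simp only [PP, Finset.range_zero, Finset.sum_empty, rle]
    symm
    rw [Nat.cast_eq_zero, Finset.card_eq_zero, Finset.filter_eq_empty_iff]
    rintro ⟨i', J⟩ hc ⟨_, h⟩
    have := hpos _ _ hc
    simp only at h
    omega
  | succ e ih =>
    have h1 : PP (patOf Λ A F) i (e + 1) = PP (patOf Λ A F) i e + rcnt Λ A F i e := by
      simp only [PP, Finset.sum_range_succ]
      rw [patOf_le (i := (i : ℕ) + 1) i.2, patOf_le i.2.le, cnt_succ]
      push_cast; ring
    rw [h1, ih, ← Nat.cast_add]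
    congr 1
    unfold rle rcnt
    rw [← Finset.card_union_of_disjoint]
    · congr 1
      ext c
      simp only [Finset.mem_filter, Finset.mem_union, Fin.ext_iff]
      constructor
      · rintro (⟨a, b, c⟩ | ⟨a, b, c⟩) <;> exact ⟨a, b, by omega⟩
      · rintro ⟨a, b, c⟩
        rcases Nat.le_succ_iff.1 c with h | h
        · exact Or.inl ⟨a, b, h⟩
        · exact Or.inr ⟨a, b, h⟩
    · rw [Finset.disjoint_left]
      intro c h1 h2
      simp only [Finset.mem_filter] at h1 h2
      omega

section
variable {n : ℕ} {Λ A : Fin n → ℤ} {F : Fin n → ℤ → ℕ} {μ : Fin n → ℕ}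

theorem LR_row (h : IsLRFilling n Λ A μ F) (i : Fin n) (J : ℤ) (hc : (i, J) ∈ cellsOf n Λ A)
    (d : ℕ) : (i, J + 2 * d) ∈ cellsOf n Λ A → F i J ≤ F i (J + 2 * d) := by
  induction d with
  | zero => intro _; simp
  | succ d ih =>
    intro hd
    have h1 := mem_cells.1 hc
    have h2 := mem_cells.1 hd
    have h3 : (i, J + 2 * d) ∈ cellsOf n Λ A :=
      mem_cells.2 ⟨by omega, by push_cast at h2; omega, by omega⟩
    have e : J + 2 * ((d + 1 : ℕ) : ℤ) = J + 2 * d + 2 := by push_cast; ring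
    rw [e] at hd ⊢
    exact (ih h3).trans (h.2.2.2.1 i _ h3 hd)

theorem LR_row' (h : IsLRFilling n Λ A μ F) (i : Fin n) (J J' : ℤ)
    (hc : (i, J) ∈ cellsOf n Λ A) (hc' : (i, J') ∈ cellsOf n Λ A) (hJ : J ≤ J') :
    F i J ≤ F i J' := by
  have h1 := mem_cells.1 hc
  have h2 := mem_cells.1 hc'
  have e : J' = J + 2 * (((J' - J) / 2).toNat : ℤ) := by omega
  rw [e] at hc' ⊢
  exact LR_row h i J hc _ hc'

theorem LR_rep (h : IsLRFilling n Λ A μ F) : FillRep Λ A (patOf Λ A F) F := by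
  refine ⟨h.2.1, ?_⟩
  intro i J hc e
  have hpos : ∀ i J, (i, J) ∈ cellsOf n Λ A → 1 ≤ F i J := fun i J hc => (h.2.2.1 i J hc).1
  have hm := mem_cells.1 hc
  have hp := h.1 i
  rw [XX, PP_patOf hpos]
  constructor
  · intro hF
    have h1 := card_row (Λ := Λ) (A := A) i (Λ i) ((J - Λ i) / 2).toNat hp.2 le_rfl (by omega)
      (fun c => c.1 = i ∧ c.2 ≤ J) (by
        rintro ⟨i', J'⟩ hc'
        have h2 := mem_cells.1 hc'
        simp only
        constructor
        · rintro ⟨rfl, b⟩; exact ⟨rfl, h2.1, by omega⟩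
        · rintro ⟨rfl, b, c⟩; exact ⟨rfl, by omega⟩)
    have h3 : ((cellsOf n Λ A).filter (fun c => c.1 = i ∧ c.2 ≤ J)).card ≤ rle Λ A F i e := by
      refine Finset.card_le_card ?_
      rintro ⟨i', J'⟩ hx
      simp only [Finset.mem_filter] at hx ⊢
      obtain ⟨a, rfl, c⟩ := hx
      exact ⟨a, rfl, (LR_row' h _ _ _ a hc c).trans hF⟩
    omega
  · intro hJ
    by_contra hF
    have h1 := card_row (Λ := Λ) (A := A) i (Λ i) ((J - 2 - Λ i) / 2).toNat hp.2 le_rfl (by omega)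
      (fun c => c.1 = i ∧ c.2 < J) (by
        rintro ⟨i', J'⟩ hc'
        have h2 := mem_cells.1 hc'
        simp only
        constructor
        · rintro ⟨rfl, b⟩; exact ⟨rfl, h2.1, by omega⟩
        · rintro ⟨rfl, b, c⟩; exact ⟨rfl, by omega⟩)
    have h3 : rle Λ A F i e ≤ ((cellsOf n Λ A).filter (fun c => c.1 = i ∧ c.2 < J)).card := by
      refine Finset.card_le_card ?_
      rintro ⟨i', J'⟩ hx
      simp only [Finset.mem_filter] at hx ⊢
      obtain ⟨a, rfl, c⟩ := hx
      refine ⟨a, rfl, ?_⟩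
      by_contra hcon
      have := LR_row' h _ _ _ hc a (not_lt.1 hcon)
      omega
    omega

theorem rle_le (h : IsLRFilling n Λ A μ F) (i : Fin n) (e : ℕ) :
    Λ i + 2 * (rle Λ A F i e : ℤ) ≤ A i := by
  have hp := h.1 i
  have h1 := card_row (Λ := Λ) (A := A) i (Λ i) ((A i - Λ i) / 2).toNat hp.2 le_rfl (by omega)
      (fun c => c.1 = i) (by
        rintro ⟨i', J'⟩ hc'
        have h2 := mem_cells.1 hc'
        simp only
        constructor
        · rintro rfl; exact ⟨rfl, h2.1, by omega⟩
        · rintro ⟨rfl, b, c⟩; exact rfl)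
  have h3 : rle Λ A F i e ≤ ((cellsOf n Λ A).filter (fun c => c.1 = i)).card := by
    refine Finset.card_le_card ?_
    intro c hx
    simp only [Finset.mem_filter] at hx ⊢
    exact ⟨hx.1, hx.2.1⟩
  omega

theorem LR_num (h : IsLRFilling n Λ A μ F) : PatNum Λ A (patOf Λ A F) := by
  have hpos : ∀ i J, (i, J) ∈ cellsOf n Λ A → 1 ≤ F i J := fun i J hc => (h.2.2.1 i J hc).1
  refine ⟨fun i => (h.1 i).2, ?_, ?_, ?_⟩
  · intro i e
    rw [XX, PP_patOf hpos]
    exact rle_le h i e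
  · intro i r
    rw [patOf_le i.2.le, patOf_le (i := (i : ℕ) + 1) i.2]
    exact_mod_cast cnt_mono r (Nat.le_succ i)
  · intro r
    rw [patOf_le (Nat.zero_le n), cnt_zero]; rfl

theorem LR_full (h : IsLRFilling n Λ A μ F) (i : Fin n) : XX Λ (patOf Λ A F) i n = A i := by
  apply le_antisymm ((LR_num h).le i n)
  have hp := h.1 i
  rcases hp.1.eq_or_lt with h1 | h1
  · rw [← h1]; exact XX_ge (LR_num h) i n
  · have hc : (i, A i) ∈ cellsOf n Λ A := mem_cells.2 ⟨h1, le_rfl, by simp⟩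
    exact ((LR_rep h).on i _ hc n).1 (h.2.2.1 i _ hc).2

theorem LR_cnt_n (h : IsLRFilling n Λ A μ F) (e : Fin n) : cnt Λ A F n e = μ e := by
  rw [← h.2.2.2.2.2.1 e]
  unfold cnt
  congr 1
  ext c
  simp

theorem LR_cnt_big (h : IsLRFilling n Λ A μ F) (i e : ℕ) (he : n ≤ e) : cnt Λ A F i e = 0 := by
  unfold cnt
  rw [Finset.card_eq_zero, Finset.filter_eq_empty_iff]
  rintro ⟨i', J⟩ hc ⟨_, h1⟩
  have := (h.2.2.1 _ _ hc).2
  simp only at h1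
  omega

theorem LR_dn (h : IsLRFilling n Λ A μ F) (i : Fin n) (r : ℕ) :
    cnt Λ A F (i + 1) (r + 1) ≤ cnt Λ A F i r := by
  have hr := LR_rep h
  refine le_trans (le_trans (Finset.card_le_card ?_)
    (h.2.2.2.2.2.2 i (XX Λ (patOf Λ A F) i (r + 1) + 1) r)) (Finset.card_le_card ?_)
  · rintro ⟨i', J⟩ hx
    simp only [Finset.mem_filter] at hx ⊢
    obtain ⟨a, b, c⟩ := hx
    refine ⟨a, ?_, c⟩
    rcases Nat.lt_succ_iff_lt_or_eq.1 b with hb | hb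
    · exact Or.inl hb
    · have hb' : i' = i := Fin.ext hb
      subst hb'
      refine Or.inr ⟨rfl, ?_⟩
      have := hr.on _ _ a (r + 1)
      omega
  · rintro ⟨i', J⟩ hx
    simp only [Finset.mem_filter] at hx ⊢
    obtain ⟨a, b, c⟩ := hx
    refine ⟨a, ?_, c⟩
    rcases b with hb | ⟨rfl, hb⟩
    · exact hb
    · have := hr.on _ _ a (r + 1)
      omega

theorem LR_GT (h : IsLRFilling n Λ A μ F) (C : ℕ) (hμ : ∀ e, μ e ≤ C) :
    GT n C (patOf Λ A F) := by
  have hn := LR_num h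
  refine ⟨hn.zero, ?_, ?_, ?_, ?_, ?_⟩
  · intro i hi r; simp [patOf, not_le.2 hi]
  · intro i hi r
    rw [patOf_le hi.le, patOf_le (i := i + 1) hi]
    exact_mod_cast LR_dn h ⟨i, hi⟩ r
  · intro i hi r
    exact hn.mono ⟨i, hi⟩ r
  · intro i r; unfold patOf; split_ifs <;> simp
  · intro i r
    by_cases hi : i ≤ n
    · rw [patOf_le hi]
      have h1 : cnt Λ A F i r ≤ cnt Λ A F n r := cnt_mono r hi
      by_cases hr : r < n
      · have h2 := LR_cnt_n h ⟨r, hr⟩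
        have h3 := hμ ⟨r, hr⟩
        simp only at h2
        omega
      · rw [LR_cnt_big h _ _ (by omega)]; simp
    · simp [patOf, hi]

end

/-- A Littlewood-Richardson filling with the star condition gives a good pattern. -/
theorem LR_GG {n C : ℕ} {Λ V : Fin n → ℤ} {F : Fin n → ℤ → ℕ} {μ : Fin n → ℕ}
    (hΛd : ∀ i j : Fin n, i ≤ j → Λ j ≤ Λ i) (hpar : ∀ i j, Λ i % 2 = Λ j % 2)
    (hVd : ∀ i j : Fin n, i ≤ j → V j ≤ V i) (hV0 : ∀ i, 0 ≤ V i)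
    (hμ : ∀ e, μ e ≤ C) (h : IsLRFilling n Λ (fun i => V i + (C : ℤ)) μ F)
    (hs : StarCond n Λ (fun i => V i + (C : ℤ)) C F) :
    GG n C Λ V (patOf Λ (fun i => V i + (C : ℤ)) F) := by
  have hg := LR_GT h C hμ
  have hn := LR_num h
  have hr := LR_rep h
  have hfull := LR_full h
  have hpat : ∀ i e, i ≤ n → patOf Λ (fun i => V i + (C : ℤ)) F i e
    = cnt Λ (fun i => V i + (C : ℤ)) F i e := fun i e hi => patOf_le hi
  have hdata := h.1
  have hcol := h.2.2.2.2.1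
  generalize hgg : patOf Λ (fun i => V i + (C : ℤ)) F = g at *
  refine ⟨hg, (good_XX hg hpar).2 ⟨?_, ?_⟩, ?_⟩
  · intro i i' hi e he
    by_contra hcon
    have hlt : i < i' := by rw [Fin.lt_def]; omega
    have h1 := XX_ge hn i e
    have h2 := hn.le i' (e + 1)
    have h3 := XX_par hn i' (e + 1)
    have h4 := hVd i i' hlt.le
    have h5 := hΛd i i' hlt.le
    have h6 := hpar i i'
    have h7 := hdata i
    have h8 := hdata i'
    simp only at h2 h3 h7 h8
    have c1 : (i, XX Λ g i' (e + 1)) ∈ cellsOf n Λ (fun i => V i + (C : ℤ)) :=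
      mem_cells.2 ⟨by omega, by omega, by omega⟩
    have c2 : (i', XX Λ g i' (e + 1)) ∈ cellsOf n Λ (fun i => V i + (C : ℤ)) :=
      mem_cells.2 ⟨by omega, by omega, by omega⟩
    have h9 := hcol i i' _ hlt c1 c2
    have h10 := (hr.on _ _ c2 (e + 1)).2 le_rfl
    have h11 := (hr.on _ _ c1 e).not.2 hcon
    omega
  · intro i hi
    have key : ∀ d, d ≤ n → (C : ℤ) ≤ XX Λ g i (n - d) + g n (n - d) := by
      intro d
      induction d with
      | zero =>
        intro _
        have h1 := hfull i
        have h2 := hV0 i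
        have h3 := hg.nonneg n n
        simp only [Nat.sub_zero] at *
        linarith
      | succ d ih =>
        intro hd
        have ih := ih (by omega)
        obtain ⟨e, he⟩ : ∃ e, e = n - (d + 1) := ⟨_, rfl⟩
        have he1 : n - d = e + 1 := by omega
        rw [he1] at ih
        rw [← he]
        have hX := XX_succ Λ g i e
        rw [hi] at hX
        have hup := hg.up i i.2 e
        have hdn := hg.dn i i.2 e
        rw [hi] at hup hdn
        rcases hup.eq_or_lt with h0 | h0
        · rw [h0] at hX hdn
          linarith
        · have h1 := hn.le i (e + 1)
          have h2 := XX_par hn i e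
          have h3 := XX_ge hn i e
          have c1 : (i, XX Λ g i e + 2) ∈ cellsOf n Λ (fun i => V i + (C : ℤ)) :=
            mem_cells.2 ⟨by omega, by omega, by omega⟩
          have hF : F i (XX Λ g i e + 2) = e + 1 := by
            have a1 := hr.on _ _ c1 e
            have a2 := hr.on _ _ c1 (e + 1)
            omega
          have hst := hs i hi _ c1
          rw [hF] at hst
          have hle := star_le (Λ := Λ) (A := fun i => V i + (C : ℤ)) (F := F) i hi
            (XX Λ g i e + 2) e
          have hrr := right_row hn hr i _ e c1 hF
          have hc := hpat i e i.2.le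
          have hle' := (Nat.cast_le (α := ℤ)).2 hle
          push_cast at hle'
          linarith
    intro e he
    have := key (n - e) (by omega)
    rwa [show n - (n - e) = e by omega] at this
  · intro i
    have h1 := hfull i
    rw [XX_wt hg] at h1
    linarith


theorem LRbar_eq {n C : ℕ} {Λ V : Fin n → ℤ} {μ : Fin n → ℕ}
    (hΛd : ∀ i j : Fin n, i ≤ j → Λ j ≤ Λ i) (hpar : ∀ i j, Λ i % 2 = Λ j % 2)
    (hVd : ∀ i j : Fin n, i ≤ j → V j ≤ V i) (hV0 : ∀ i, 0 ≤ V i)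
    (hμ : ∀ e, μ e ≤ C) :
    LRbar n Λ (fun i => V i + (C : ℤ)) μ C
      = (((BB n C).filter (GG n C Λ V)).filter
          (fun g => (fun e : Fin n => (g n e).toNat) = μ)).card := by
  unfold LRbar
  rw [← Nat.card_eq_finsetCard]
  refine Nat.card_congr (Equiv.ofBijective
    (fun F => ⟨patOf Λ (fun i => V i + (C : ℤ)) F.1, ?_⟩) ⟨?_, ?_⟩)
  · have hG := LR_GG hΛd hpar hVd hV0 hμ F.2.1 F.2.2
    simp only [Finset.mem_filter, mem_BB]
    refine ⟨⟨hG.gt, hG⟩, ?_⟩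
    funext e
    rw [patOf_le le_rfl, LR_cnt_n F.2.1 e]
    simp
  · rintro ⟨F, hF⟩ ⟨F', hF'⟩ e
    have e' := congrArg Subtype.val e
    simp only at e'
    have h1 := LR_rep hF.1
    have h2 := LR_rep hF'.1
    rw [e'] at h1
    exact Subtype.ext (rep_unique h1 h2)
  · rintro ⟨g, hg⟩
    simp only [Finset.mem_filter, mem_BB] at hg
    obtain ⟨⟨hgt, hG⟩, hm⟩ := hg
    obtain ⟨F, hF⟩ := exists_rep hG.num hG.XXn
    have hLR := rep_LR hG hpar hF μ (fun e => by
      rw [← hm]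
      simp [hgt.nonneg n e])
    refine ⟨⟨F, hLR⟩, Subtype.ext ?_⟩
    funext i e
    simp only
    by_cases hi : i ≤ n
    · rw [patOf_le hi, cnt_eq hG.num hF e i hi]
    · rw [hgt.out i (by omega)]
      simp [patOf, hi]

theorem sum_LRbar {n C : ℕ} {Λ V : Fin n → ℤ}
    (hΛd : ∀ i j : Fin n, i ≤ j → Λ j ≤ Λ i) (hpar : ∀ i j, Λ i % 2 = Λ j % 2)
    (hVd : ∀ i j : Fin n, i ≤ j → V j ≤ V i) (hV0 : ∀ i, 0 ≤ V i) :
    ∑ μ ∈ ((Fintype.piFinset fun _ : Fin n => Finset.range (C + 1)).filter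
        (fun μ => Antitone μ)), LRbar n Λ (fun i => V i + (C : ℤ)) μ C
      = ((BB n C).filter (GG n C Λ V)).card := by
  rw [Finset.card_eq_sum_card_fiberwise (f := fun g => (fun e : Fin n => (g n e).toNat))
    (t := (Fintype.piFinset fun _ : Fin n => Finset.range (C + 1)).filter
        (fun μ => Antitone μ))]
  · refine Finset.sum_congr rfl fun μ hμ => ?_
    simp only [Finset.mem_filter, Fintype.mem_piFinset, Finset.mem_range] at hμ
    exact LRbar_eq hΛd hpar hVd hV0 (fun e => by have := hμ.1 e; omega)
  · intro g hg
    simp only [Finset.coe_filter, Set.mem_setOf_eq, mem_BB] at hg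
    have hgt := hg.1
    simp only [Finset.coe_filter, Set.mem_setOf_eq, Fintype.mem_piFinset, Finset.mem_range]
    constructor
    · intro e
      have := hgt.le n e
      omega
    · have anti : Antitone (g n) := by
        refine antitone_nat_of_succ_le fun r => ?_
        rcases Nat.eq_zero_or_pos n with h0 | h0
        · subst h0; rw [hgt.zero, hgt.zero]
        · have h1 := hgt.dn (n - 1) (by omega) r
          have h2 := hgt.up (n - 1) (by omega) r
          rw [show n - 1 + 1 = n by omega] at h1 h2
          exact h1.trans h2
      intro e e' hee
      exact Int.toNat_le_toNat (anti hee)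

theorem soOdd_eq {F : Type} [Field F] (n : ℕ) (L : Fin n → ℤ) (y : Fin n → F) :
    soOdd n L y = aa y (fun i => L i + 2 * (n : ℤ) - 2 * ((i : ℕ) : ℤ) - 1)
      / aa y (fun i => 2 * (n : ℤ) - 2 * ((i : ℕ) : ℤ) - 1) := rfl

theorem wt_bounds {n C g} (h : GT n C g) (i : Fin n) : wt n C g i ≤ C := by
  have h1 : Ss n g (i + 1) ≤ C + Ss n g i := by
    unfold Ss
    rw [Finset.sum_range_succ', Finset.sum_range_succ, h.supp i n i.2.le]
    have : ∑ k ∈ range n, g (i + 1) (k + 1) ≤ ∑ k ∈ range n, g i k :=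
      Finset.sum_le_sum fun k _ => h.dn i i.2 k
    linarith [h.le (i + 1) 0]
  unfold wt
  linarith

/-- The weights of good patterns are dominant. -/
theorem GG.dominant {n C g} {Λ V : Fin n → ℤ} (h : GG n C Λ V g)
    (hpar : ∀ i j, Λ i % 2 = Λ j % 2) :
    (∀ i j : Fin n, i ≤ j → V j ≤ V i) ∧ (∀ i, 0 ≤ V i) := by
  have H := (good_XX h.gt hpar).1 h.good
  have h1 : ∀ i j : Fin n, i ≤ j → V j ≤ V i := by
    intro i j hij
    rcases hij.eq_or_lt with e | hlt
    · rw [e]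
    · have hlt' : (i : ℕ) < j := hlt
      have h2 := h.col hpar n le_rfl (j - i - 1) i j (by omega)
      rw [XX_stable h.gt j (n + 1) (by omega), h.XXn, h.XXn] at h2
      linarith
  refine ⟨h1, fun i => ?_⟩
  have hn : 0 < n := i.pos
  refine le_trans ?_ (h1 i ⟨n - 1, by omega⟩ (by rw [Fin.le_def]; have := i.2; simp only; omega))
  have h3 := H.2 ⟨n - 1, by omega⟩ (by simp only; omega) n le_rfl
  rw [h.XXn, h.gt.supp n n le_rfl] at h3
  linarith

theorem main_identity {F : Type} [Field F] [CharZero F] (n C : ℕ) (y : Fin n → F)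
    (hy : ∀ j, y j ≠ 0) (Λ : Fin n → ℤ)
    (hΛd : ∀ i j : Fin n, i ≤ j → Λ j ≤ Λ i) (hΛ0 : ∀ i, 0 ≤ Λ i)
    (hpar : ∀ i j, Λ i % 2 = Λ j % 2) :
    chi n C y * aa y (fun i => Λ i + 2 * (n : ℤ) - 2 * ((i : ℕ) : ℤ) - 1)
      = ∑ g ∈ (BB n C).filter (Good n C (lfun Λ)),
          aa y (fun i => (Λ i + wt n C g i) + 2 * (n : ℤ) - 2 * ((i : ℕ) : ℤ) - 1) := by
  rw [chi_mul_aa n C y hy, sum_good n C y (lfun Λ) (lfun_nonneg hΛd hΛ0)]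
  · refine Finset.sum_congr rfl fun g _ => ?_
    congr 1
    funext i
    ring
  · intro k h
    have := lfun_mid hpar k ⟨k + 1, h⟩ rfl
    simp only
    push_cast
    linarith
  · intro k h
    have := lfun_last (Λ := Λ) k h
    have h' : (n : ℤ) = k + 1 := by exact_mod_cast h.symm
    rw [this, h']
    ring

theorem soOdd_mul {F : Type} [Field F] [CharZero F] (n C : ℕ) (y : Fin n → F)
    (hy : ∀ j, y j ≠ 0) (Λ : Fin n → ℤ)
    (hΛd : ∀ i j : Fin n, i ≤ j → Λ j ≤ Λ i) (hΛ0 : ∀ i, 0 ≤ Λ i)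
    (hpar : ∀ i j, Λ i % 2 = Λ j % 2) :
    soOdd n (fun _ : Fin n => (C : ℤ)) y * soOdd n Λ y
      = ∑ g ∈ (BB n C).filter (Good n C (lfun Λ)), soOdd n (fun i => Λ i + wt n C g i) y := by
  by_cases hD : aa y (fun i => 2 * (n : ℤ) - 2 * ((i : ℕ) : ℤ) - 1) = 0
  · simp only [soOdd_eq, hD, div_zero, mul_zero, Finset.sum_const_zero]
  have h0 : chi n C y * aa y (fun i => 2 * (n : ℤ) - 2 * ((i : ℕ) : ℤ) - 1)
      = aa y (fun i => C + 2 * (n : ℤ) - 2 * ((i : ℕ) : ℤ) - 1) := by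
    have h1 := main_identity n C y hy (fun _ => 0) (fun _ _ _ => le_rfl) (fun _ => le_rfl)
      (fun _ _ => rfl)
    have h2 : lfun (fun _ : Fin n => (0 : ℤ)) = fun _ => 0 := by
      funext k
      simp [lfun]
    rw [h2, filter_good_zero, Finset.sum_singleton, wt_gmax] at h1
    simpa using h1
  have hchi : soOdd n (fun _ : Fin n => (C : ℤ)) y = chi n C y := by
    rw [soOdd_eq, ← h0, mul_div_assoc, div_self hD, mul_one]
  rw [hchi, soOdd_eq, ← mul_div_assoc, main_identity n C y hy Λ hΛd hΛ0 hpar, Finset.sum_div]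
  rfl

theorem soOdd_final {F : Type} [Field F] [CharZero F] (n C : ℕ) (y : Fin n → F)
    (hy : ∀ j, y j ≠ 0) (Λ : Fin n → ℤ)
    (hΛd : ∀ i j : Fin n, i ≤ j → Λ j ≤ Λ i) (hΛ0 : ∀ i, 0 ≤ Λ i)
    (hpar : ∀ i j, Λ i % 2 = Λ j % 2) :
    soOdd n (fun _ : Fin n => (C : ℤ)) y * soOdd n Λ y
      = ∑ V ∈ ((Fintype.piFinset fun i : Fin n =>
            Finset.Icc (0 : ℤ) (Λ i + C)).filter
            (fun V => (∀ i j : Fin n, i ≤ j → V j ≤ V i) ∧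
              (∀ i, (Λ i + C - V i) % 2 = 0))),
          soOdd n V y *
            (∑ μ ∈ ((Fintype.piFinset fun _ : Fin n => Finset.range (C + 1)).filter
                (fun μ => Antitone μ)),
              (LRbar n Λ (fun i => V i + C) μ (C : ℤ) : F)) := by
  rw [soOdd_mul n C y hy Λ hΛd hΛ0 hpar]
  rw [← Finset.sum_fiberwise_of_maps_to
    (t := ((Fintype.piFinset fun i : Fin n =>
            Finset.Icc (0 : ℤ) (Λ i + C)).filter
            (fun V => (∀ i j : Fin n, i ≤ j → V j ≤ V i) ∧
              (∀ i, (Λ i + C - V i) % 2 = 0))))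
    (g := fun g => (fun i => Λ i + wt n C g i))]
  · refine Finset.sum_congr rfl fun V hV => ?_
    simp only [Finset.mem_filter, Fintype.mem_piFinset, Finset.mem_Icc] at hV
    obtain ⟨hV1, hVd, hVp⟩ := hV
    have hs := sum_LRbar (C := C) hΛd hpar hVd (fun i => (hV1 i).1)
    rw [← Nat.cast_sum, hs]
    have hsum : ∀ g ∈ ((BB n C).filter (Good n C (lfun Λ))).filter
        (fun g => (fun i => Λ i + wt n C g i) = V),
        soOdd n (fun i => Λ i + wt n C g i) y = soOdd n V y := by
      intro g hg
      rw [(Finset.mem_filter.1 hg).2]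
    rw [Finset.sum_congr rfl hsum, Finset.sum_const, nsmul_eq_mul, mul_comm]
    congr 3
    ext g
    simp only [Finset.mem_filter, mem_BB]
    constructor
    · rintro ⟨⟨a, b⟩, c⟩
      exact ⟨a, a, b, fun i => by rw [← c]⟩
    · rintro ⟨a, b⟩
      exact ⟨⟨a, b.good⟩, funext fun i => (b.weight i).symm⟩
  · intro g hg
    simp only [Finset.mem_filter, mem_BB] at hg
    have hG : GG n C Λ (fun i => Λ i + wt n C g i) g := ⟨hg.1, hg.2, fun _ => rfl⟩
    obtain ⟨d1, d2⟩ := hG.dominant hpar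
    simp only [Finset.mem_filter, Fintype.mem_piFinset, Finset.mem_Icc]
    refine ⟨fun i => ⟨d2 i, ?_⟩, d1, fun i => ?_⟩
    · linarith [wt_bounds hg.1 i]
    · unfold wt; omega

theorem Xv_ne_zero (n : ℕ) (j : Fin n) : Xv n j ≠ 0 := by
  unfold Xv
  intro h
  have := (IsFractionRing.injective (MvPolynomial (Fin n) ℚ) (FF n)) (h.trans (map_zero _).symm)
  exact MvPolynomial.X_ne_zero j this

/-- `so_{2n+1}((c^n)) · so_{2n+1}(λ) = ∑_{ν ⊆ λ+(c^n)} so_{2n+1}(ν)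
· ∑_{μ ⊆ ((2c)^n)} LRbar^{ν+(c^n)}_{λ,μ}(c)`.  Stated in doubled coordinates:
`C = 2c`, `Λ = 2λ`, `V = 2ν`, variables `y` with `x_j = y_j²`. -/
theorem soOddRect_mul_soOdd
    (n C : ℕ) (Λ : Fin n → ℤ)
    (hΛd : ∀ i j : Fin n, i ≤ j → Λ j ≤ Λ i) (hΛ0 : ∀ i, 0 ≤ Λ i)
    (hpar : ∀ i j, Λ i % 2 = Λ j % 2) :
    soOdd n (fun _ : Fin n => (C : ℤ)) (Xv n) * soOdd n Λ (Xv n)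
      = ∑ V ∈ ((Fintype.piFinset fun i : Fin n =>
            Finset.Icc (0 : ℤ) (Λ i + C)).filter
            (fun V => (∀ i j : Fin n, i ≤ j → V j ≤ V i) ∧
              (∀ i, (Λ i + C - V i) % 2 = 0))),
          soOdd n V (Xv n) *
            (∑ μ ∈ ((Fintype.piFinset fun _ : Fin n => Finset.range (C + 1)).filter
                (fun μ => Antitone μ)),
              (LRbar n Λ (fun i => V i + C) μ (C : ℤ) : FF n)) := by
  have : CharZero (FF n) := charZero_of_injective_algebraMap
    (IsFractionRing.injective (MvPolynomial (Fin n) ℚ) (FF n))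
  exact soOdd_final n C (Xv n) (Xv_ne_zero n) Λ hΛd hΛ0 hpar

end
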